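/- arXiv:1602.06449 — 4 statements merged into one kernel-verified Lean document; each statement's English description precedes it below -/
import Mathlib

section
/- Basepoint-change lemma. Let G be a Gauss diagram on n strings and let G' be obtained from G by a single basepoint move (moving the basepoint of one string past one endpoint of an arrow g ∼ (i,j)). Then for every t ∈ {1,…,n} there exist integers a_{J;j} such that ⟨Z_{n;t},G⟩ − ⟨Z_{n;t},G'⟩ = Σ_{j=1}^{n} Σ_{J ∈ 𝓘_j} a_{J;j}·⟨Z_{J;j},G⟩, where (writing [a,b] = {a, a+1, …, b}, with [a,b] = ∅ for a > b and [a,a] = {a}) the index families are 𝓘_t = { [1,i] ∪ [k,n] : i = 1,…,n−1; i+1 < k ≤ n+1; t ∈ [1,i] or t ∈ [k,n] } ∪ { [1,k] ∪ [i,n] : 0 ≤ k < i−1; i ≤ n; t ∈ [1,k] or t ∈ [i,n] }, and 𝓘_j = { [k,m] : 1 ≤ k ≤ j; j ≤ m ≤ n; k < m } for j ≠ t. -/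
open scoped BigOperators

/-!  Combinatorial framework for Gauss diagrams of (string) links and for the
Kravchenko–Polyak tree diagrams/tree invariants (following the paper
"Tree invariants and Milnor linking numbers with indeterminacy").

Strings of a diagram on `n` strings are indexed by `1, …, n`; each string is
oriented downward from a basepoint at its top, and the position of an endpoint
on its string is a rational number which increases from top to bottom. -/

/-- A Gauss diagram on `n` strings: a finite type of signed arrows, each with a
head endpoint and a tail endpoint lying on strings `1,…,n`, all endpoints
distinct, the endpoints on each string being linearly ordered (top-to-bottom)
by their position. An endpoint is encoded as a pair `(g, b)` where `b = true`
designates the head of the arrow `g` and `b = false` its tail. -/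
structure GaussDiagram (n : ℕ) where
  Arrow : Type
  fin : Fintype Arrow
  dec : DecidableEq Arrow
  /-- the string carrying the head of an arrow -/
  hs : Arrow → ℕ
  /-- the string carrying the tail of an arrow -/
  ts : Arrow → ℕ
  /-- the position of the head on its string (positions increase downward) -/
  hp : Arrow → ℚ
  /-- the position of the tail on its string -/
  tp : Arrow → ℚ
  /-- the sign `ε(g) ∈ {+1, -1}` of an arrow -/
  sign : Arrow → ℤ
  hs_mem : ∀ g, hs g ∈ Finset.Icc 1 n
  ts_mem : ∀ g, ts g ∈ Finset.Icc 1 n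
  sign_unit : ∀ g, sign g = 1 ∨ sign g = -1
  /-- all endpoints are distinct -/
  distinct : ∀ e e' : Arrow × Bool,
    (if e.2 then hs e.1 else ts e.1) = (if e'.2 then hs e'.1 else ts e'.1) →
    (if e.2 then hp e.1 else tp e.1) = (if e'.2 then hp e'.1 else tp e'.1) →
    e = e'

attribute [instance] GaussDiagram.fin GaussDiagram.dec

namespace GaussDiagram

variable {n : ℕ}

/-- the string on which an endpoint lies -/
def estr (G : GaussDiagram n) (e : G.Arrow × Bool) : ℕ :=
  if e.2 then G.hs e.1 else G.ts e.1

/-- the position of an endpoint on its string -/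
def epos (G : GaussDiagram n) (e : G.Arrow × Bool) : ℚ :=
  if e.2 then G.hp e.1 else G.tp e.1

end GaussDiagram

/-- The data of a tree diagram.  By axiom (d2), a tree diagram with leaves
indexed by `I` and trunk `j` has exactly one arrow tailed at each string
`i ∈ I \ {j}`, so its arrows are canonically indexed by `I.erase j`:
`par i` is the string carrying the head of the arrow tailed at string `i`
(the "parent" string), and `rk i` is the rank (counted from the top, starting
at `0`) of the head of this arrow among all the arrowheads lying on the string
`par i`.  By axiom (d4) the tail on a string lies below all the heads on that
string, so `par` and `rk` determine the diagram up to isomorphism.  Junk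
values are pinned by `par i = i` and `rk i = 0` outside `I.erase j`. -/
structure PreTree where
  par : ℕ → ℕ
  rk : ℕ → ℕ

namespace PreTree

/-- `A` is a tree diagram with leaves indexed by `I` and trunk `j`:
axioms (d1)–(d4), together with canonicality of the ranks and the pinning of
junk values. -/
def IsTreeDiagram (I : Finset ℕ) (j : ℕ) (A : PreTree) : Prop :=
  (∀ i ∈ I.erase j, A.par i ∈ I ∧ A.par i ≠ i ∧
      A.rk i < (((I.erase j).filter fun b => A.par b = A.par i)).card) ∧
  (∀ i ∈ I.erase j, ∀ i' ∈ I.erase j,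
      A.par i = A.par i' → A.rk i = A.rk i' → i = i') ∧
  (∀ i, i ∉ I.erase j → A.par i = i ∧ A.rk i = 0)

/-- `A` is planar: the associated rooted tree admits a planar embedding in
which the strings appear in increasing left-to-right order.  Concretely, the
arrows can be drawn as horizontal segments at pairwise distinct heights
`h i` (heights increase downward), compatibly with the order of the endpoints
on each string, in such a way that no arrow crosses the retained part of an
intermediate string (in particular no arrow passes over the trunk). -/
def IsPlanar (I : Finset ℕ) (j : ℕ) (A : PreTree) : Prop :=
  ∃ h : ℕ → ℚ,
    (∀ i ∈ I.erase j, ∀ i' ∈ I.erase j, h i = h i' → i = i') ∧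
    (∀ i ∈ I.erase j, ∀ i' ∈ I.erase j, A.par i = A.par i' →
        (A.rk i < A.rk i' ↔ h i < h i')) ∧
    (∀ i ∈ I.erase j, ∀ i' ∈ I.erase j, A.par i = i' → h i < h i') ∧
    (∀ a ∈ I.erase j, ∀ k ∈ I, min (A.par a) a < k → k < max (A.par a) a →
        k ≠ j ∧ h k < h a)

end PreTree

/-- `𝒜(I;j)`: the set of planar tree diagrams with leaves indexed by `I` and
trunk `j`. -/
def TreeSet (I : Finset ℕ) (j : ℕ) : Set PreTree :=
  {A | A.IsTreeDiagram I j ∧ A.IsPlanar I j}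

/-- `𝒜(n;r) = 𝒜({1,…,n};r)`. -/
def TreeSetFull (n r : ℕ) : Set PreTree :=
  TreeSet (Finset.Icc 1 n) r

/-- `sign(A) = (-1)^q` where `q` is the number of arrows of `A` pointing to
the right, i.e. whose head lies on a higher-indexed string than the tail. -/
def treeSign (I : Finset ℕ) (j : ℕ) (A : PreTree) : ℤ :=
  (-1) ^ (((I.erase j).filter fun i => i < A.par i)).card

/-- A representation `φ` of the tree diagram `A` (with leaves `I`, trunk `j`)
in the Gauss diagram `G`: an injective map from the arrows of `A` (indexed by
their tail strings) to the arrows of `G`, preserving head strings, tail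
strings, and the top-to-bottom order of the endpoints on each string. -/
def IsRep {n : ℕ} (G : GaussDiagram n) (I : Finset ℕ) (j : ℕ) (A : PreTree)
    (φ : {x // x ∈ I.erase j} → G.Arrow) : Prop :=
  Function.Injective φ ∧
  (∀ a, G.hs (φ a) = A.par a.1) ∧
  (∀ a, G.ts (φ a) = a.1) ∧
  (∀ a a', A.par a.1 = A.par a'.1 →
      (A.rk a.1 < A.rk a'.1 ↔ G.hp (φ a) < G.hp (φ a'))) ∧
  (∀ a a', A.par a.1 = a'.1 → G.hp (φ a) < G.tp (φ a'))

/-- `sign(φ) = ∏_{α ∈ A} ε(φ(α))`. -/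
noncomputable def repSign {n : ℕ} (G : GaussDiagram n) {s : Finset ℕ}
    (φ : {x // x ∈ s} → G.Arrow) : ℤ :=
  ∏ᶠ a, G.sign (φ a)

/-- `⟨A,G⟩ = ∑_φ sign(φ)`, the sum over all representations of `A` in `G`. -/
noncomputable def pair {n : ℕ} (G : GaussDiagram n) (I : Finset ℕ) (j : ℕ)
    (A : PreTree) : ℤ :=
  ∑ᶠ (φ : {x // x ∈ I.erase j} → G.Arrow) (_ : IsRep G I j A φ), repSign G φ

/-- `⟨A,G⟩_{α ↦ g}`: the part of `⟨A,G⟩` coming from representations sending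
the arrow `α` of `A` tailed at the string `a` to the arrow `g` of `G`. -/
noncomputable def pairTo {n : ℕ} (G : GaussDiagram n) (I : Finset ℕ) (j : ℕ)
    (A : PreTree) (a : {x // x ∈ I.erase j}) (g : G.Arrow) : ℤ :=
  ∑ᶠ (φ : {x // x ∈ I.erase j} → G.Arrow) (_ : IsRep G I j A φ ∧ φ a = g),
    repSign G φ

/-- `⟨A,G⟩_{α ↛ g}`: the part of `⟨A,G⟩` coming from representations not
sending the arrow `α` of `A` tailed at the string `a` to the arrow `g`. -/
noncomputable def pairNotTo {n : ℕ} (G : GaussDiagram n) (I : Finset ℕ) (j : ℕ)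
    (A : PreTree) (a : {x // x ∈ I.erase j}) (g : G.Arrow) : ℤ :=
  ∑ᶠ (φ : {x // x ∈ I.erase j} → G.Arrow) (_ : IsRep G I j A φ ∧ φ a ≠ g),
    repSign G φ

/-- The tree pairing `⟨Z_{I;j},G⟩ = ∑_{A ∈ 𝒜(I;j)} sign(A)⟨A,G⟩`. -/
noncomputable def Zpair {n : ℕ} (G : GaussDiagram n) (I : Finset ℕ) (j : ℕ) : ℤ :=
  ∑ᶠ (A : PreTree) (_ : A ∈ TreeSet I j), treeSign I j A * pair G I j A

/-- `Δ_Z(I;·) = gcd{⟨Z_{J;k},G⟩ : J ⊊ I, k ∈ J}`. -/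
noncomputable def DeltaZ {n : ℕ} (G : GaussDiagram n) (I : Finset ℕ) : ℤ :=
  (((I.powerset.erase I).sigma fun J => J)).gcd fun p => Zpair G p.1 p.2
/-! ### Moves on Gauss diagrams -/

/-- The endpoints `e₁` and `e₂` (lying on a common string) are consecutive on
their string: no other endpoint lies strictly between them. -/
def Consecutive {n : ℕ} (G : GaussDiagram n) (e₁ e₂ : G.Arrow × Bool) : Prop :=
  ∀ e : G.Arrow × Bool, e ≠ e₁ → e ≠ e₂ → G.estr e = G.estr e₁ →
    ¬ (min (G.epos e₁) (G.epos e₂) < G.epos e ∧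
        G.epos e < max (G.epos e₁) (G.epos e₂))

/-- `ψ` matches arrows of `G` with arrows of `G'` preserving signs, head
strings and tail strings. -/
def ArrowMap {n : ℕ} (G G' : GaussDiagram n) (ψ : G.Arrow → G'.Arrow) : Prop :=
  (∀ g, G'.sign (ψ g) = G.sign g) ∧ (∀ g, G'.hs (ψ g) = G.hs g) ∧
  (∀ g, G'.ts (ψ g) = G.ts g)

/-- `ψ` preserves the relative (top-to-bottom) order of all pairs of endpoints
lying on a common string, except possibly for pairs meeting the set `S`. -/
def OrderPresOn {n : ℕ} (G G' : GaussDiagram n) (ψ : G.Arrow → G'.Arrow)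
    (S : Set (G.Arrow × Bool)) : Prop :=
  ∀ e e' : G.Arrow × Bool, e ∉ S → e' ∉ S → G.estr e = G.estr e' →
    (G.epos e < G.epos e' ↔ G'.epos (ψ e.1, e.2) < G'.epos (ψ e'.1, e'.2))

/-- Basepoint move: on one string, the topmost endpoint becomes the bottommost
endpoint of that string (or vice versa); all other data are unchanged. -/
def BasepointMove {n : ℕ} (G G' : GaussDiagram n) : Prop :=
  ∃ ψ : G.Arrow ≃ G'.Arrow, ArrowMap G G' ψ ∧
    ∃ e₀ : G.Arrow × Bool,
      OrderPresOn G G' ψ {e₀} ∧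
      ((∀ e, e ≠ e₀ → G.estr e = G.estr e₀ →
          G.epos e₀ < G.epos e ∧ G'.epos (ψ e.1, e.2) < G'.epos (ψ e₀.1, e₀.2)) ∨
       (∀ e, e ≠ e₀ → G.estr e = G.estr e₀ →
          G.epos e < G.epos e₀ ∧ G'.epos (ψ e₀.1, e₀.2) < G'.epos (ψ e.1, e.2)))

/-- Insertion of an isolated arrow `g₀` whose head and tail are consecutive
endpoints on a single string (first Reidemeister move). -/
def R1Ins {n : ℕ} (G G' : GaussDiagram n) : Prop :=
  ∃ (ψ : G.Arrow → G'.Arrow) (g₀ : G'.Arrow),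
    Function.Injective ψ ∧ ArrowMap G G' ψ ∧ OrderPresOn G G' ψ ∅ ∧
    (∀ g, ψ g ≠ g₀) ∧ (∀ h, h ≠ g₀ → ∃ g, ψ g = h) ∧
    G'.hs g₀ = G'.ts g₀ ∧ Consecutive G' (g₀, true) (g₀, false)

/-- First Reidemeister move (insertion or deletion). -/
def R1Move {n : ℕ} (G G' : GaussDiagram n) : Prop :=
  R1Ins G G' ∨ R1Ins G' G

/-- Insertion of a parallel pair `g₊, g₋` of arrows of opposite signs, with
heads consecutive on a common string and tails consecutive on a common string,
in parallel position (second Reidemeister move). -/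
def R2Ins {n : ℕ} (G G' : GaussDiagram n) : Prop :=
  ∃ (ψ : G.Arrow → G'.Arrow) (gp gm : G'.Arrow),
    Function.Injective ψ ∧ ArrowMap G G' ψ ∧ OrderPresOn G G' ψ ∅ ∧
    gp ≠ gm ∧ (∀ g, ψ g ≠ gp ∧ ψ g ≠ gm) ∧
    (∀ h, h ≠ gp → h ≠ gm → ∃ g, ψ g = h) ∧
    G'.sign gp = - G'.sign gm ∧ G'.hs gp = G'.hs gm ∧ G'.ts gp = G'.ts gm ∧
    Consecutive G' (gp, true) (gm, true) ∧
    Consecutive G' (gp, false) (gm, false) ∧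
    (G'.hp gp < G'.hp gm ↔ G'.tp gp < G'.tp gm)

/-- Second Reidemeister move (insertion or deletion). -/
def R2Move {n : ℕ} (G G' : GaussDiagram n) : Prop :=
  R2Ins G G' ∨ R2Ins G' G

/-- Third Reidemeister move: the three designated pairs of consecutive
endpoints of the positive arrows `g ∼ (i₁,i₂)`, `h ∼ (i₁,i₃)`, `k ∼ (i₂,i₃)`
have their relative order reversed, all other relative orders of endpoints
being preserved. -/
def R3Move {n : ℕ} (G G' : GaussDiagram n) : Prop :=
  ∃ (ψ : G.Arrow ≃ G'.Arrow) (g h k : G.Arrow),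
    ArrowMap G G' ψ ∧
    g ≠ h ∧ g ≠ k ∧ h ≠ k ∧
    G.sign g = 1 ∧ G.sign h = 1 ∧ G.sign k = 1 ∧
    G.hs h = G.hs g ∧ G.hs k = G.ts g ∧ G.ts k = G.ts h ∧
    Consecutive G (g, true) (h, true) ∧
    Consecutive G (g, false) (k, true) ∧
    Consecutive G (h, false) (k, false) ∧
    (G.epos (g, true) < G.epos (h, true) ↔
      G'.epos (ψ h, true) < G'.epos (ψ g, true)) ∧
    (G.epos (g, false) < G.epos (k, true) ↔
      G'.epos (ψ k, true) < G'.epos (ψ g, false)) ∧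
    (G.epos (h, false) < G.epos (k, false) ↔
      G'.epos (ψ k, false) < G'.epos (ψ h, false)) ∧
    (∀ e e' : G.Arrow × Bool, G.estr e = G.estr e' →
      ¬ (({e, e'} : Set (G.Arrow × Bool)) = {(g, true), (h, true)} ∨
         ({e, e'} : Set (G.Arrow × Bool)) = {(g, false), (k, true)} ∨
         ({e, e'} : Set (G.Arrow × Bool)) = {(h, false), (k, false)}) →
      (G.epos e < G.epos e' ↔ G'.epos (ψ e.1, e.2) < G'.epos (ψ e'.1, e'.2)))

/-- `G` and `G'` have identical sets of arrows with head and tail on distinct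
strings (same signs, same head/tail strings, same relative order of the
endpoints of these arrows on each string); they may differ arbitrarily in
arrows whose head and tail lie on the same string.  This is the equivalence
generated by the self-arrow moves (insertion, deletion, sign change of an
arrow with both endpoints on one string). -/
def MixedEquiv {n : ℕ} (G G' : GaussDiagram n) : Prop :=
  ∃ ψ : {g : G.Arrow // G.hs g ≠ G.ts g} ≃ {g : G'.Arrow // G'.hs g ≠ G'.ts g},
    (∀ g, G'.sign (ψ g).1 = G.sign g.1) ∧
    (∀ g, G'.hs (ψ g).1 = G.hs g.1) ∧
    (∀ g, G'.ts (ψ g).1 = G.ts g.1) ∧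
    (∀ (g g' : {g : G.Arrow // G.hs g ≠ G.ts g}) (b b' : Bool),
      G.estr (g.1, b) = G.estr (g'.1, b') →
      (G.epos (g.1, b) < G.epos (g'.1, b') ↔
        G'.epos ((ψ g).1, b) < G'.epos ((ψ g').1, b')))

/-- A single arrow `g` of `G` is replaced by the arrow `g' = ψ g` of `G'` with
the same sign, head string and tail string, in a possibly different position;
all other arrows and all relative orders of their endpoints are unchanged. -/
def MovedArrow {n : ℕ} (G G' : GaussDiagram n) (g : G.Arrow) (g' : G'.Arrow) :
    Prop :=
  ∃ ψ : G.Arrow ≃ G'.Arrow, ψ g = g' ∧ ArrowMap G G' ψ ∧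
    ∀ e e' : G.Arrow × Bool, e.1 ≠ g → e'.1 ≠ g → G.estr e = G.estr e' →
      (G.epos e < G.epos e' ↔ G'.epos (ψ e.1, e.2) < G'.epos (ψ e'.1, e'.2))
/-! ### Stacking of planar tree diagrams -/

/-- Relabelling of the strings of `P` (a planar tree diagram on the strings
`1,…,n` with trunk `r`) when a diagram on `m` strings with trunk `s` is stacked
onto its `k`-th leaf: strings left of `k` keep their index, the `k`-th string
is glued onto the trunk of the stacked diagram (index `k+s-1`), and strings
right of `k` are shifted by `m-1`. -/
def embP (k m s p : ℕ) : ℕ :=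
  if p < k then p else if p = k then k + s - 1 else p + m - 1

/-- The inverse relabelling: the string of `P` from which the string `i` of
`P ≺ₖ Q` originates. -/
def invP (k m s i : ℕ) : ℕ :=
  if i < k then i else if i = k + s - 1 then k else i - (m - 1)

/-- The number of arrowheads lying on the trunk string of the tree diagram `Q`
on `m` strings with trunk `s`. -/
def qcount (m s : ℕ) (Q : PreTree) : ℕ :=
  ((((Finset.Icc 1 m).erase s)).filter fun q => Q.par q = s).card

/-- The stacking `P ≺ₖ Q` of the tree diagram `Q` (on `m` strings, trunk `s`)
onto the `k`-th leaf of the tree diagram `P`: the trunk string of `Q` is glued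
onto the `k`-th leaf string of `P` (the arrows of `Q` lying above those of `P`
on the glued string) and the resulting strings are renumbered `1,…,n+m-1` in
left-to-right planar order, the strings of `Q` occupying positions
`k,…,k+m-1`. -/
def stack (k m s : ℕ) (P Q : PreTree) : PreTree where
  par i :=
    if k ≤ i ∧ i ≤ k + m - 1 ∧ i ≠ k + s - 1 then
      k + Q.par (i - k + 1) - 1
    else
      embP k m s (P.par (invP k m s i))
  rk i :=
    if k ≤ i ∧ i ≤ k + m - 1 ∧ i ≠ k + s - 1 then
      Q.rk (i - k + 1)
    else if P.par (invP k m s i) = k ∧ invP k m s i ≠ k then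
      P.rk (invP k m s i) + qcount m s Q
    else
      P.rk (invP k m s i)

/-- The trunk of `P ≺ₖ Q` (where `P` has trunk `r` and `Q` has `m` strings and
trunk `s`). -/
def stackTrunk (r k m s : ℕ) : ℕ :=
  if r < k then r else if k < r then r + m - 1 else k + s - 1

/-- The elementary tree `e ∈ 𝒜(2;1)`: one arrow with head on string `1` (the
trunk) and tail on string `2`. -/
def etree : PreTree :=
  ⟨fun i => if i = 2 then 1 else i, fun _ => 0⟩

/-- The elementary tree `ē ∈ 𝒜(2;2)`: one arrow with head on string `2` (the
trunk) and tail on string `1`. -/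
def ebar : PreTree :=
  ⟨fun i => if i = 1 then 2 else i, fun _ => 0⟩

/-- The `k`-th smallest element of the finite set `I` (`1`-indexed). -/
def enumIn (I : Finset ℕ) (k : ℕ) : ℕ :=
  (I.sort (· ≤ ·)).getD (k - 1) 0

/-- The (`1`-indexed) rank of `x` in the finite set `I`. -/
def rankIn (I : Finset ℕ) (x : ℕ) : ℕ :=
  ((I.filter fun y => y ≤ x)).card

/-- Relabel a tree diagram on the strings `1,…,|I|` so that its strings are
indexed by the elements of `I` (in increasing order); this realizes a tree
diagram `A' ∈ 𝒜(I;·)` from `A ∈ 𝒜(|I|;·)` as in the pairing `⟨A, G(I)⟩`. -/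
def relabel (I : Finset ℕ) (P : PreTree) : PreTree where
  par x := if x ∈ I then enumIn I (P.par (rankIn I x)) else x
  rk x := if x ∈ I then P.rk (rankIn I x) else 0
/-- The index family `𝓘_t` of the basepoint-change lemma (for the trunk
component `t`), consisting of the subsets `[1,i] ∪ [k,n]` with
`i = 1,…,n-1`, `i+1 < k ≤ n+1`, `t ∈ [1,i]` or `t ∈ [k,n]`, and the subsets
`[1,k] ∪ [i,n]` with `0 ≤ k < i-1`, `i ≤ n`, `t ∈ [1,k]` or `t ∈ [i,n]`. -/
def famT (n t : ℕ) : Set (Finset ℕ) :=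
  {J | ∃ i k, 1 ≤ i ∧ i ≤ n - 1 ∧ i + 1 < k ∧ k ≤ n + 1 ∧
      ((1 ≤ t ∧ t ≤ i) ∨ (k ≤ t ∧ t ≤ n)) ∧
      J = Finset.Icc 1 i ∪ Finset.Icc k n} ∪
  {J | ∃ i k, k + 1 < i ∧ i ≤ n ∧
      ((1 ≤ t ∧ t ≤ k) ∨ (i ≤ t ∧ t ≤ n)) ∧
      J = Finset.Icc 1 k ∪ Finset.Icc i n}

/-- The index family `𝓘_j` (for `j ≠ t`), consisting of the intervals `[k,m]`
with `1 ≤ k ≤ j ≤ m ≤ n` and `k < m`. -/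
def famJ (n j : ℕ) : Set (Finset ℕ) :=
  {J | ∃ k m, 1 ≤ k ∧ k ≤ j ∧ j ≤ m ∧ m ≤ n ∧ k < m ∧ J = Finset.Icc k m}

/-- The head and tail strings, head and tail positions and signs of a family of arrows. -/
structure ArrowData (α : Type*) where
  hs : α → ℕ
  ts : α → ℕ
  hp : α → ℚ
  tp : α → ℚ
  sign : α → ℤ

namespace ArrowData

open Relation

variable {α : Type*}

/-- `F` is the image of a representation of a (not necessarily planar) tree diagram with leaves
indexed by `I` and trunk `t`. -/
structure IsConfig (D : ArrowData α) (I : Finset ℕ) (t : ℕ) (F : Finset α) : Prop where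
  ts_mem : ∀ f ∈ F, D.ts f ∈ I
  ts_ne : ∀ f ∈ F, D.ts f ≠ t
  hs_mem : ∀ f ∈ F, D.hs f ∈ I
  hs_ne : ∀ f ∈ F, D.hs f ≠ D.ts f
  surj : ∀ i ∈ I, i ≠ t → ∃ f ∈ F, D.ts f = i
  inj : ∀ f ∈ F, ∀ f' ∈ F, D.ts f = D.ts f' → f = f'
  above : ∀ f ∈ F, ∀ f' ∈ F, D.hs f = D.ts f' → D.hp f < D.tp f'

/-- The arrows of `F` can be drawn as horizontal segments at the heights `h` (increasing downward)
without crossing the retained part of an intermediate string. -/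
structure IsHeight (D : ArrowData α) (I : Finset ℕ) (F : Finset α) (h : α → ℚ) : Prop where
  inj : ∀ f ∈ F, ∀ f' ∈ F, h f = h f' → f = f'
  order : ∀ f ∈ F, ∀ f' ∈ F, D.hs f = D.hs f' → (D.hp f < D.hp f' ↔ h f < h f')
  lt : ∀ f ∈ F, ∀ f' ∈ F, D.hs f = D.ts f' → h f < h f'
  cross : ∀ f ∈ F, ∀ k ∈ I, min (D.hs f) (D.ts f) < k → k < max (D.hs f) (D.ts f) →
    ∃ f' ∈ F, D.ts f' = k ∧ h f' < h f

/-- `F` is the image of a representation of a planar tree diagram with leaves indexed by `I` and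
trunk `t`. -/
def IsPlanarConfig (D : ArrowData α) (I : Finset ℕ) (t : ℕ) (F : Finset α) : Prop :=
  D.IsConfig I t F ∧ ∃ h, D.IsHeight I F h

/-- An arrow of `F` leads from the string `a` to the string `b`. -/
def Step (D : ArrowData α) (F : Finset α) (a b : ℕ) : Prop :=
  ∃ f ∈ F, D.ts f = a ∧ D.hs f = b

variable {D D' : ArrowData α} {I : Finset ℕ} {t : ℕ} {F : Finset α} {h : α → ℚ}

theorem height_induction [Finite α] (h : α → ℚ) {P : α → Prop}
    (H : ∀ f, (∀ f', h f < h f' → P f') → P f) (f : α) : P f := by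
  have wf : WellFounded fun f f' : α => h f' < h f :=
    @Finite.wellFounded_of_trans_of_irrefl α _ (fun f f' => h f' < h f)
      ⟨fun _ _ _ h₁ h₂ => h₂.trans h₁⟩ ⟨fun _ => lt_irrefl _⟩
  exact wf.induction f H

theorem IsConfig.reach [Finite α] (c : D.IsConfig I t F) (hh : D.IsHeight I F h) {k : ℕ}
    (hk : k ∈ I) : ReflTransGen (D.Step F) k t := by
  have key : ∀ f, f ∈ F → ReflTransGen (D.Step F) (D.ts f) t := by
    intro f
    induction f using height_induction h with | _ f ih
    intro hf
    by_cases ht : D.hs f = t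
    · exact .single ⟨f, hf, rfl, ht⟩
    · obtain ⟨f', hf', e⟩ := c.surj _ (c.hs_mem f hf) ht
      exact .head ⟨f, hf, rfl, e.symm⟩ (ih f' (hh.lt f hf f' hf' e.symm) hf')
  by_cases ht : k = t
  · exact ht ▸ .refl
  · obtain ⟨f, hf, e⟩ := c.surj k hk ht
    exact e ▸ key f hf

theorem IsHeight.lt_of_reach (hh : D.IsHeight I F h) {f g : α} (hf : f ∈ F) (hg : g ∈ F)
    (r : ReflTransGen (D.Step F) (D.hs f) (D.ts g)) : h f < h g := by
  have key : ∀ a, ReflTransGen (D.Step F) a (D.ts g) → ∀ f ∈ F, D.hs f = a → h f < h g := by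
    intro a ha
    induction ha using ReflTransGen.head_induction_on with
    | refl => exact fun f hf e => hh.lt f hf g hg e
    | head s _ ih =>
      obtain ⟨f', hf', e₁, e₂⟩ := s
      exact fun f hf e => (hh.lt f hf f' hf' (e.trans e₁.symm)).trans (ih f' hf' e₂)
  exact key _ r f hf rfl

theorem IsConfig.reach_of_between [Finite α] (c : D.IsConfig I t F) (hh : D.IsHeight I F h)
    {f : α} (hf : f ∈ F) {m : ℕ} (hm : m ∈ I) (h₁ : min (D.hs f) (D.ts f) < m)
    (h₂ : m < max (D.hs f) (D.ts f)) :
    ReflTransGen (D.Step F) m (D.hs f) ∧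
      ∃ f' ∈ F, h f' < h f ∧ (D.hs f' = D.hs f ∨ D.hs f' = D.ts f) := by
  have key : ∀ f', f' ∈ F → h f' < h f → min (D.hs f) (D.ts f) < D.ts f' →
      D.ts f' < max (D.hs f) (D.ts f) → ReflTransGen (D.Step F) (D.ts f') (D.hs f) ∧
      ∃ f' ∈ F, h f' < h f ∧ (D.hs f' = D.hs f ∨ D.hs f' = D.ts f) := by
    intro f'
    induction f' using height_induction h with | _ f' ih
    intro hf' hlt l₁ l₂
    by_cases e₁ : D.hs f' = D.hs f
    · exact ⟨.single ⟨f', hf', rfl, e₁⟩, f', hf', hlt, .inl e₁⟩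
    by_cases e₂ : D.hs f' = D.ts f
    · exact ⟨.head ⟨f', hf', rfl, e₂⟩ (.single ⟨f, hf, rfl, rfl⟩), f', hf', hlt, .inr e₂⟩
    have np : ¬ (min (D.hs f') (D.ts f') < D.hs f ∧ D.hs f < max (D.hs f') (D.ts f')) := by
      rintro ⟨l₃, l₄⟩
      obtain ⟨f₁, hf₁, e, l⟩ := hh.cross f' hf' _ (c.hs_mem f hf) l₃ l₄
      have := hh.lt f hf f₁ hf₁ e.symm
      linarith
    have nq : ¬ (min (D.hs f') (D.ts f') < D.ts f ∧ D.ts f < max (D.hs f') (D.ts f')) := by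
      rintro ⟨l₃, l₄⟩
      obtain ⟨f₁, hf₁, e, l⟩ := hh.cross f' hf' _ (c.ts_mem f hf) l₃ l₄
      have := c.inj _ hf₁ _ hf e
      subst this
      linarith
    have l₃ : min (D.hs f) (D.ts f) < D.hs f' := by omega
    have l₄ : D.hs f' < max (D.hs f) (D.ts f) := by omega
    obtain ⟨f₁, hf₁, e, l⟩ := hh.cross f hf _ (c.hs_mem f' hf') l₃ l₄
    obtain ⟨r, x⟩ := ih f₁ (hh.lt f' hf' f₁ hf₁ e.symm) hf₁ l (e ▸ l₃) (e ▸ l₄)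
    exact ⟨.head ⟨f', hf', rfl, e.symm⟩ r, x⟩
  obtain ⟨f₁, hf₁, e, l⟩ := hh.cross f hf m hm h₁ h₂
  exact e ▸ key f₁ hf₁ l (e ▸ h₁) (e ▸ h₂)

theorem IsConfig.reach_convex [Finite α] (c : D.IsConfig I t F) (hh : D.IsHeight I F h)
    {a j m : ℕ} (r : ReflTransGen (D.Step F) a j) (hm : m ∈ I) (h₁ : min a j ≤ m)
    (h₂ : m ≤ max a j) : ReflTransGen (D.Step F) m j := by
  induction r using ReflTransGen.head_induction_on with
  | refl => obtain rfl : m = j := by omega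
            exact .refl
  | @head a b s r ih =>
    obtain ⟨f, hf, rfl, rfl⟩ := s
    by_cases hma : m = D.ts f
    · exact hma ▸ .head ⟨f, hf, rfl, rfl⟩ r
    by_cases hmb : min (D.hs f) j ≤ m ∧ m ≤ max (D.hs f) j
    · exact ih hmb.1 hmb.2
    · exact (c.reach_of_between hh hf hm (by omega) (by omega)).1.trans r

open Classical in
/-- The strings of the subtree of `F` above the string `j`. -/
noncomputable def desc (D : ArrowData α) (I : Finset ℕ) (F : Finset α) (j : ℕ) : Finset ℕ :=
  {k ∈ I | ReflTransGen (D.Step F) k j}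

theorem mem_desc {j k : ℕ} : k ∈ D.desc I F j ↔ k ∈ I ∧ ReflTransGen (D.Step F) k j := by
  simp [desc]

/-- The strings left after collapsing the subtree on `S` to its trunk `j`. -/
def collapse (I S : Finset ℕ) (j : ℕ) : Finset ℕ := I \ S.erase j

theorem IsConfig.notMem_desc_trunk (c : D.IsConfig I t F) {j : ℕ} (hj : j ≠ t) :
    t ∉ D.desc I F j := by
  rw [mem_desc]
  rintro ⟨-, r⟩
  rcases r.cases_head with e | ⟨_, ⟨f, hf, e, -⟩, -⟩
  · exact hj e.symm
  · exact c.ts_ne f hf e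

theorem IsConfig.ts_mem_desc (c : D.IsConfig I t F) {j : ℕ} {f : α} (hf : f ∈ F)
    (hs : D.hs f ∈ D.desc I F j) : D.ts f ∈ D.desc I F j :=
  mem_desc.2 ⟨c.ts_mem f hf, .head ⟨f, hf, rfl, rfl⟩ (mem_desc.1 hs).2⟩

theorem IsConfig.hs_mem_desc (c : D.IsConfig I t F) {j : ℕ} {f : α} (hf : f ∈ F)
    (hs : D.ts f ∈ D.desc I F j) (hj : D.ts f ≠ j) : D.hs f ∈ D.desc I F j := by
  refine mem_desc.2 ⟨c.hs_mem f hf, ?_⟩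
  rcases (mem_desc.1 hs).2.cases_head with e | ⟨b, ⟨f', hf', e, rfl⟩, r⟩
  · exact (hj e).elim
  · rwa [← c.inj f' hf' f hf e]

section split

variable {g : α}

theorem IsPlanarConfig.subtree (c : D.IsPlanarConfig I t F) (hg : g ∈ F) :
    D.IsPlanarConfig (D.desc I F (D.ts g)) (D.ts g)
      {f ∈ F | D.ts f ∈ (D.desc I F (D.ts g)).erase (D.ts g)} := by
  obtain ⟨c, h, hh⟩ := c
  refine ⟨⟨?_, ?_, ?_, ?_, ?_, ?_, ?_⟩, h, ?_, ?_, ?_, ?_⟩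
  · intro f hf; simp only [Finset.mem_filter, Finset.mem_erase] at hf; exact hf.2.2
  · intro f hf; simp only [Finset.mem_filter, Finset.mem_erase] at hf; exact hf.2.1
  · intro f hf; simp only [Finset.mem_filter, Finset.mem_erase] at hf
    exact c.hs_mem_desc hf.1 hf.2.2 hf.2.1
  · intro f hf; exact c.hs_ne f (Finset.mem_filter.1 hf).1
  · intro i hi hne
    have hi' := mem_desc.1 hi
    have hit : i ≠ t := by
      rintro rfl
      exact c.notMem_desc_trunk (c.ts_ne g hg) hi
    obtain ⟨f, hf, rfl⟩ := c.surj i hi'.1 hit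
    exact ⟨f, by simp [hf, hne, hi], rfl⟩
  · intro f hf f' hf'
    exact c.inj f (Finset.mem_filter.1 hf).1 f' (Finset.mem_filter.1 hf').1
  · intro f hf f' hf'
    exact c.above f (Finset.mem_filter.1 hf).1 f' (Finset.mem_filter.1 hf').1
  · intro f hf f' hf'
    exact hh.inj f (Finset.mem_filter.1 hf).1 f' (Finset.mem_filter.1 hf').1
  · intro f hf f' hf'
    exact hh.order f (Finset.mem_filter.1 hf).1 f' (Finset.mem_filter.1 hf').1
  · intro f hf f' hf'
    exact hh.lt f (Finset.mem_filter.1 hf).1 f' (Finset.mem_filter.1 hf').1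
  · intro f hf k hk l₁ l₂
    simp only [Finset.mem_filter, Finset.mem_erase] at hf
    obtain ⟨f', hf', rfl, l⟩ := hh.cross f hf.1 k (mem_desc.1 hk).1 l₁ l₂
    refine ⟨f', ?_, rfl, l⟩
    simp only [Finset.mem_filter, Finset.mem_erase]
    refine ⟨hf', fun e => ?_, hk⟩
    obtain rfl := c.inj _ hf' _ hg e
    have := hh.lt_of_reach hf.1 hg (mem_desc.1 (c.hs_mem_desc hf.1 hf.2.2 hf.2.1)).2
    linarith

theorem IsPlanarConfig.hs_notMem_desc (c : D.IsPlanarConfig I t F) (hg : g ∈ F) {f : α}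
    (hf : f ∈ F) (hts : D.ts f ∉ (D.desc I F (D.ts g)).erase (D.ts g)) :
    D.hs f ∉ D.desc I F (D.ts g) := by
  obtain ⟨c, h, hh⟩ := c
  intro hs
  have h₁ := c.ts_mem_desc hf hs
  have h₂ : D.ts f = D.ts g := by
    by_contra hne
    exact hts (Finset.mem_erase.2 ⟨hne, h₁⟩)
  obtain rfl := c.inj _ hf _ hg h₂
  exact lt_irrefl _ (hh.lt_of_reach hf hf (mem_desc.1 hs).2)

theorem IsPlanarConfig.ts_mem_desc_self (c : D.IsPlanarConfig I t F) (hg : g ∈ F) :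
    D.ts g ∈ D.desc I F (D.ts g) := mem_desc.2 ⟨c.1.ts_mem g hg, .refl⟩

theorem IsPlanarConfig.collapse (c : D.IsPlanarConfig I t F) (hg : g ∈ F) :
    D.IsPlanarConfig (collapse I (D.desc I F (D.ts g)) (D.ts g)) t
      {f ∈ F | D.ts f ∉ (D.desc I F (D.ts g)).erase (D.ts g)} := by
  have hnd := fun f hf => c.hs_notMem_desc (f := f) hg hf
  obtain ⟨c, h, hh⟩ := c
  refine ⟨⟨?_, ?_, ?_, ?_, ?_, ?_, ?_⟩, h, ?_, ?_, ?_, ?_⟩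
  · intro f hf; rw [Finset.mem_filter] at hf
    exact Finset.mem_sdiff.2 ⟨c.ts_mem f hf.1, hf.2⟩
  · intro f hf; exact c.ts_ne f (Finset.mem_filter.1 hf).1
  · intro f hf; rw [Finset.mem_filter] at hf
    exact Finset.mem_sdiff.2 ⟨c.hs_mem f hf.1,
      fun hm => hnd f hf.1 hf.2 (Finset.mem_of_mem_erase hm)⟩
  · intro f hf; exact c.hs_ne f (Finset.mem_filter.1 hf).1
  · intro i hi hne
    obtain ⟨hi, hi'⟩ := Finset.mem_sdiff.1 hi
    obtain ⟨f, hf, rfl⟩ := c.surj i hi hne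
    exact ⟨f, Finset.mem_filter.2 ⟨hf, hi'⟩, rfl⟩
  · intro f hf f' hf'
    exact c.inj f (Finset.mem_filter.1 hf).1 f' (Finset.mem_filter.1 hf').1
  · intro f hf f' hf'
    exact c.above f (Finset.mem_filter.1 hf).1 f' (Finset.mem_filter.1 hf').1
  · intro f hf f' hf'
    exact hh.inj f (Finset.mem_filter.1 hf).1 f' (Finset.mem_filter.1 hf').1
  · intro f hf f' hf'
    exact hh.order f (Finset.mem_filter.1 hf).1 f' (Finset.mem_filter.1 hf').1
  · intro f hf f' hf'
    exact hh.lt f (Finset.mem_filter.1 hf).1 f' (Finset.mem_filter.1 hf').1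
  · intro f hf k hk l₁ l₂
    obtain ⟨hk, hk'⟩ := Finset.mem_sdiff.1 hk
    obtain ⟨f', hf', rfl, l⟩ := hh.cross f (Finset.mem_filter.1 hf).1 k hk l₁ l₂
    exact ⟨f', Finset.mem_filter.2 ⟨hf', hk'⟩, rfl, l⟩

end split

/-- Two height functions can be merged, the first family of arrows being drawn on top of the
second one. -/
theorem exists_merged_height [Finite α] (F₁ F₂ : Finset α) (hd : Disjoint F₁ F₂)
    (h₁ h₂ : α → ℚ) :
    ∃ h : α → ℚ, (∀ f ∈ F₁, ∀ f' ∈ F₁, (h f < h f' ↔ h₁ f < h₁ f')) ∧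
      (∀ f ∈ F₂, ∀ f' ∈ F₂, (h f < h f' ↔ h₂ f < h₂ f')) ∧
      ∀ f ∈ F₁, ∀ f' ∈ F₂, h f < h f' := by
  classical
  obtain ⟨B, hB⟩ := (Set.finite_range h₁).bddAbove
  obtain ⟨C, hC⟩ := (Set.finite_range h₂).bddBelow
  have hn : ∀ f ∈ F₂, f ∉ F₁ := fun f hf hf' => Finset.disjoint_left.1 hd hf' hf
  refine ⟨fun f => if f ∈ F₁ then h₁ f - B + C - 1 else h₂ f, ?_, ?_, ?_⟩
  · intro f hf f' hf'
    simp [hf, hf']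
  · intro f hf f' hf'
    simp [hn f hf, hn f' hf']
  · intro f hf f' hf'
    have := hB (Set.mem_range_self f)
    have := hC (Set.mem_range_self f')
    simp only [hf, hn f' hf', if_true, if_false]
    linarith

theorem IsPlanarConfig.union [Finite α] [DecidableEq α] {S : Finset ℕ} {F₁ F₂ : Finset α} {g : α}
    (c₁ : D.IsPlanarConfig S (D.ts g) F₁)
    (c₂ : D.IsPlanarConfig (ArrowData.collapse I S (D.ts g)) t F₂)
    (hg : g ∈ F₂) (hleaf : ∀ f ∈ F₂, D.hs f ≠ D.ts g)
    (habove : ∀ f ∈ F₁, D.hs f = D.ts g → D.hp f < D.tp g)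
    (hSI : S ⊆ I) (htS : t ∉ S) (hjS : D.ts g ∈ S)
    (hconv : ∀ a ∈ S, ∀ b ∈ S, ∀ k ∈ I, a < k → k < b → k ∈ S) :
    D.IsPlanarConfig I t (F₁ ∪ F₂) ∧ D.desc I (F₁ ∪ F₂) (D.ts g) = S ∧
      {f ∈ F₁ ∪ F₂ | D.ts f ∈ S.erase (D.ts g)} = F₁ ∧
      {f ∈ F₁ ∪ F₂ | D.ts f ∉ S.erase (D.ts g)} = F₂ := by
  obtain ⟨c₁, h₁, hh₁⟩ := c₁
  obtain ⟨c₂, h₂, hh₂⟩ := c₂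
  have in₁ : ∀ f ∈ F₁, D.ts f ∈ S.erase (D.ts g) := fun f hf =>
    Finset.mem_erase.2 ⟨c₁.ts_ne f hf, c₁.ts_mem f hf⟩
  have in₂ : ∀ f ∈ F₂, D.ts f ∉ S.erase (D.ts g) := fun f hf =>
    (Finset.mem_sdiff.1 (c₂.ts_mem f hf)).2
  have hs₂ : ∀ f ∈ F₂, D.hs f ∉ S := fun f hf hS =>
    (Finset.mem_sdiff.1 (c₂.hs_mem f hf)).2 (Finset.mem_erase.2 ⟨hleaf f hf, hS⟩)
  have hd : Disjoint F₁ F₂ := Finset.disjoint_left.2 fun f hf hf' => in₂ f hf' (in₁ f hf)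
  obtain ⟨h, m₁, m₂, m₁₂⟩ := exists_merged_height F₁ F₂ hd h₁ h₂
  refine ⟨⟨⟨?_, ?_, ?_, ?_, ?_, ?_, ?_⟩, h, ?_, ?_, ?_, ?_⟩, ?_, ?_, ?_⟩
  · intro f hf
    rcases Finset.mem_union.1 hf with hf | hf
    · exact hSI (c₁.ts_mem f hf)
    · exact (Finset.mem_sdiff.1 (c₂.ts_mem f hf)).1
  · intro f hf
    rcases Finset.mem_union.1 hf with hf | hf
    · exact fun e => htS (e ▸ c₁.ts_mem f hf)
    · exact c₂.ts_ne f hf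
  · intro f hf
    rcases Finset.mem_union.1 hf with hf | hf
    · exact hSI (c₁.hs_mem f hf)
    · exact (Finset.mem_sdiff.1 (c₂.hs_mem f hf)).1
  · intro f hf
    rcases Finset.mem_union.1 hf with hf | hf
    · exact c₁.hs_ne f hf
    · exact c₂.hs_ne f hf
  · intro i hi hit
    by_cases hiS : i ∈ S.erase (D.ts g)
    · obtain ⟨f, hf, e⟩ := c₁.surj i (Finset.mem_of_mem_erase hiS) (Finset.ne_of_mem_erase hiS)
      exact ⟨f, Finset.mem_union_left _ hf, e⟩
    · obtain ⟨f, hf, e⟩ := c₂.surj i (Finset.mem_sdiff.2 ⟨hi, hiS⟩) hit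
      exact ⟨f, Finset.mem_union_right _ hf, e⟩
  · intro f hf f' hf' e
    rcases Finset.mem_union.1 hf with hf | hf <;> rcases Finset.mem_union.1 hf' with hf' | hf'
    · exact c₁.inj f hf f' hf' e
    · exact (in₂ f' hf' (e ▸ in₁ f hf)).elim
    · exact (in₂ f hf (e ▸ in₁ f' hf')).elim
    · exact c₂.inj f hf f' hf' e
  · intro f hf f' hf' e
    rcases Finset.mem_union.1 hf with hf | hf <;> rcases Finset.mem_union.1 hf' with hf' | hf'
    · exact c₁.above f hf f' hf' e
    · have h' : D.ts f' = D.ts g := by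
        by_contra hne
        exact in₂ f' hf' (Finset.mem_erase.2 ⟨hne, e ▸ c₁.hs_mem f hf⟩)
      obtain rfl := c₂.inj _ hf' _ hg h'
      exact habove f hf e
    · exact (hs₂ f hf (e ▸ c₁.ts_mem f' hf')).elim
    · exact c₂.above f hf f' hf' e
  · intro f hf f' hf' e
    have n₁ := lt_irrefl (h f)
    rcases Finset.mem_union.1 hf with hf | hf <;> rcases Finset.mem_union.1 hf' with hf' | hf'
    · refine hh₁.inj f hf f' hf' (le_antisymm ?_ ?_)
      · exact not_lt.1 fun l => e.not_gt ((m₁ _ hf' _ hf).2 l)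
      · exact not_lt.1 fun l => e.not_lt ((m₁ _ hf _ hf').2 l)
    · exact (e.not_lt (m₁₂ f hf f' hf')).elim
    · exact (e.not_gt (m₁₂ f' hf' f hf)).elim
    · refine hh₂.inj f hf f' hf' (le_antisymm ?_ ?_)
      · exact not_lt.1 fun l => e.not_gt ((m₂ _ hf' _ hf).2 l)
      · exact not_lt.1 fun l => e.not_lt ((m₂ _ hf _ hf').2 l)
  · intro f hf f' hf' e
    rcases Finset.mem_union.1 hf with hf | hf <;> rcases Finset.mem_union.1 hf' with hf' | hf'
    · exact (hh₁.order f hf f' hf' e).trans (m₁ f hf f' hf').symm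
    · exact (hs₂ f' hf' (e ▸ c₁.hs_mem f hf)).elim
    · exact (hs₂ f hf (e ▸ c₁.hs_mem f' hf')).elim
    · exact (hh₂.order f hf f' hf' e).trans (m₂ f hf f' hf').symm
  · intro f hf f' hf' e
    rcases Finset.mem_union.1 hf with hf | hf <;> rcases Finset.mem_union.1 hf' with hf' | hf'
    · exact (m₁ f hf f' hf').2 (hh₁.lt f hf f' hf' e)
    · exact m₁₂ f hf f' hf'
    · exact (hs₂ f hf (e ▸ c₁.ts_mem f' hf')).elim
    · exact (m₂ f hf f' hf').2 (hh₂.lt f hf f' hf' e)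
  · intro f hf k hk l₁ l₂
    rcases Finset.mem_union.1 hf with hf | hf
    · have hkS : k ∈ S := by
        have a₁ := c₁.hs_mem f hf
        have a₂ := c₁.ts_mem f hf
        rcases le_total (D.hs f) (D.ts f) with l | l
        · rw [min_eq_left l] at l₁; rw [max_eq_right l] at l₂
          exact hconv _ a₁ _ a₂ k hk l₁ l₂
        · rw [min_eq_right l] at l₁; rw [max_eq_left l] at l₂
          exact hconv _ a₂ _ a₁ k hk l₁ l₂
      obtain ⟨f', hf', e, l⟩ := hh₁.cross f hf k hkS l₁ l₂
      exact ⟨f', Finset.mem_union_left _ hf', e, (m₁ _ hf' _ hf).2 l⟩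
    · by_cases hkS : k ∈ S.erase (D.ts g)
      · obtain ⟨f', hf', e⟩ :=
          c₁.surj k (Finset.mem_of_mem_erase hkS) (Finset.ne_of_mem_erase hkS)
        exact ⟨f', Finset.mem_union_left _ hf', e, m₁₂ _ hf' _ hf⟩
      · obtain ⟨f', hf', e, l⟩ := hh₂.cross f hf k (Finset.mem_sdiff.2 ⟨hk, hkS⟩) l₁ l₂
        exact ⟨f', Finset.mem_union_right _ hf', e, (m₂ _ hf' _ hf).2 l⟩
  · ext k
    rw [mem_desc]
    constructor
    · rintro ⟨-, r⟩
      induction r using ReflTransGen.head_induction_on with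
      | refl => exact hjS
      | head s _ ih =>
        obtain ⟨f, hf, rfl, rfl⟩ := s
        rcases Finset.mem_union.1 hf with hf | hf
        · exact c₁.ts_mem f hf
        · exact (hs₂ f hf ih).elim
    · intro hk
      refine ⟨hSI hk, ReflTransGen.mono ?_ _ _ (c₁.reach hh₁ hk)⟩
      rintro a b ⟨f, hf, e⟩
      exact ⟨f, Finset.mem_union_left _ hf, e⟩
  · ext f
    simp only [Finset.mem_filter, Finset.mem_union]
    exact ⟨fun ⟨a, b⟩ => a.resolve_right fun a => in₂ f a b, fun a => ⟨.inl a, in₁ f a⟩⟩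
  · ext f
    simp only [Finset.mem_filter, Finset.mem_union]
    exact ⟨fun ⟨a, b⟩ => a.resolve_left fun a => b (in₁ f a), fun a => ⟨.inr a, in₂ f a⟩⟩

section leaf

variable {K : Finset ℕ} {g : α}

theorem IsPlanarConfig.erase [DecidableEq α] (c : D.IsPlanarConfig K t F) (hg : g ∈ F)
    (hleaf : ∀ f ∈ F, D.hs f ≠ D.ts g) :
    D.IsPlanarConfig (K.erase (D.ts g)) t (F.erase g) := by
  obtain ⟨c, h, hh⟩ := c
  have sub : ∀ f ∈ F.erase g, f ∈ F := fun f hf => Finset.mem_of_mem_erase hf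
  refine ⟨⟨?_, ?_, ?_, ?_, ?_, ?_, ?_⟩, h, ?_, ?_, ?_, ?_⟩
  · intro f hf
    refine Finset.mem_erase.2 ⟨fun e => ?_, c.ts_mem f (sub f hf)⟩
    exact Finset.ne_of_mem_erase hf (c.inj f (sub f hf) g hg e)
  · exact fun f hf => c.ts_ne f (sub f hf)
  · exact fun f hf => Finset.mem_erase.2 ⟨hleaf f (sub f hf), c.hs_mem f (sub f hf)⟩
  · exact fun f hf => c.hs_ne f (sub f hf)
  · intro i hi hit
    obtain ⟨hij, hi⟩ := Finset.mem_erase.1 hi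
    obtain ⟨f, hf, rfl⟩ := c.surj i hi hit
    exact ⟨f, Finset.mem_erase.2 ⟨fun e => hij (e ▸ rfl), hf⟩, rfl⟩
  · exact fun f hf f' hf' => c.inj f (sub f hf) f' (sub f' hf')
  · exact fun f hf f' hf' => c.above f (sub f hf) f' (sub f' hf')
  · exact fun f hf f' hf' => hh.inj f (sub f hf) f' (sub f' hf')
  · exact fun f hf f' hf' => hh.order f (sub f hf) f' (sub f' hf')
  · exact fun f hf f' hf' => hh.lt f (sub f hf) f' (sub f' hf')
  · intro f hf k hk l₁ l₂
    obtain ⟨hkj, hk⟩ := Finset.mem_erase.1 hk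
    obtain ⟨f', hf', rfl, l⟩ := hh.cross f (sub f hf) k hk l₁ l₂
    exact ⟨f', Finset.mem_erase.2 ⟨fun e => hkj (e ▸ rfl), hf'⟩, rfl, l⟩

theorem IsConfig.insert_leaf [DecidableEq α] (c : D.IsConfig (K.erase (D.ts g)) t F)
    (hjK : D.ts g ∈ K) (hjt : D.ts g ≠ t) (hiK : D.hs g ∈ K) (hij : D.hs g ≠ D.ts g)
    (habove : ∀ f ∈ F, D.ts f = D.hs g → D.hp g < D.tp f) :
    D.IsConfig K t (insert g F) := by
  have in_ts : ∀ f ∈ F, D.ts f ≠ D.ts g := fun f hf => Finset.ne_of_mem_erase (c.ts_mem f hf)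
  have in_hs : ∀ f ∈ F, D.hs f ≠ D.ts g := fun f hf => Finset.ne_of_mem_erase (c.hs_mem f hf)
  constructor
  · rw [Finset.forall_mem_insert]
    exact ⟨hjK, fun f hf => Finset.mem_of_mem_erase (c.ts_mem f hf)⟩
  · rw [Finset.forall_mem_insert]
    exact ⟨hjt, c.ts_ne⟩
  · rw [Finset.forall_mem_insert]
    exact ⟨hiK, fun f hf => Finset.mem_of_mem_erase (c.hs_mem f hf)⟩
  · rw [Finset.forall_mem_insert]
    exact ⟨hij, c.hs_ne⟩
  · intro i hi hit
    by_cases e : i = D.ts g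
    · exact ⟨g, Finset.mem_insert_self _ _, e.symm⟩
    · obtain ⟨f, hf, e'⟩ := c.surj i (Finset.mem_erase.2 ⟨e, hi⟩) hit
      exact ⟨f, Finset.mem_insert_of_mem hf, e'⟩
  · intro f hf f' hf' e
    rcases Finset.mem_insert.1 hf with rfl | m <;> rcases Finset.mem_insert.1 hf' with rfl | m'
    · rfl
    · exact (in_ts f' m' e.symm).elim
    · exact (in_ts f m e).elim
    · exact c.inj f m f' m' e
  · intro f hf f' hf' e
    rcases Finset.mem_insert.1 hf with rfl | m <;> rcases Finset.mem_insert.1 hf' with rfl | m'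
    · exact (hij e).elim
    · exact habove f' m' e.symm
    · exact (in_hs f m e).elim
    · exact c.above f m f' m' e

theorem IsHeight.insert_leaf [DecidableEq α] {h' : α → ℚ} (c : D.IsConfig (K.erase (D.ts g)) t F)
    (hh : D.IsHeight (K.erase (D.ts g)) F h)
    (hij : D.hs g ≠ D.ts g)
    (hF : ∀ f ∈ F, ∀ f' ∈ F, (h' f < h' f' ↔ h f < h f'))
    (hne : ∀ f ∈ F, h' f ≠ h' g)
    (horder : ∀ f ∈ F, D.hs f = D.hs g → (D.hp g < D.hp f ↔ h' g < h' f))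
    (horder' : ∀ f ∈ F, D.hs f = D.hs g → (D.hp f < D.hp g ↔ h' f < h' g))
    (hlt : ∀ f ∈ F, D.ts f = D.hs g → h' g < h' f)
    (hcross : ∀ k ∈ K, min (D.hs g) (D.ts g) < k → k < max (D.hs g) (D.ts g) →
      ∃ f ∈ F, D.ts f = k ∧ h' f < h' g)
    (hover : ∀ f ∈ F, min (D.hs f) (D.ts f) < D.ts g → D.ts g < max (D.hs f) (D.ts f) →
      h' g < h' f) :
    D.IsHeight K (insert g F) h' := by
  have in_hs : ∀ f ∈ F, D.hs f ≠ D.ts g := fun f hf => Finset.ne_of_mem_erase (c.hs_mem f hf)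
  constructor
  · intro f hf f' hf' e
    rcases Finset.mem_insert.1 hf with rfl | m <;> rcases Finset.mem_insert.1 hf' with rfl | m'
    · rfl
    · exact (hne f' m' e.symm).elim
    · exact (hne f m e).elim
    · refine hh.inj f m f' m' (le_antisymm ?_ ?_)
      · exact not_lt.1 fun l => e.not_gt ((hF _ m' _ m).2 l)
      · exact not_lt.1 fun l => e.not_lt ((hF _ m _ m').2 l)
  · intro f hf f' hf' e
    rcases Finset.mem_insert.1 hf with rfl | m <;> rcases Finset.mem_insert.1 hf' with rfl | m'
    · simp
    · exact horder f' m' e.symm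
    · exact horder' f m e
    · exact (hh.order f m f' m' e).trans (hF f m f' m').symm
  · intro f hf f' hf' e
    rcases Finset.mem_insert.1 hf with rfl | m <;> rcases Finset.mem_insert.1 hf' with rfl | m'
    · exact (hij e).elim
    · exact hlt f' m' e.symm
    · exact (in_hs f m e).elim
    · exact (hF f m f' m').2 (hh.lt f m f' m' e)
  · intro f hf k hk l₁ l₂
    rcases Finset.mem_insert.1 hf with rfl | hf
    · obtain ⟨f', hf', e⟩ := hcross k hk l₁ l₂
      exact ⟨f', Finset.mem_insert_of_mem hf', e⟩
    · by_cases e : k = D.ts g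
      · subst e
        exact ⟨g, Finset.mem_insert_self _ _, rfl, hover f hf l₁ l₂⟩
      · obtain ⟨f', hf', e', l⟩ := hh.cross f hf k (Finset.mem_erase.2 ⟨e, hk⟩) l₁ l₂
        exact ⟨f', Finset.mem_insert_of_mem hf', e', (hF f' hf' f hf).2 l⟩

/-- The head of `g` is the topmost endpoint of its string. -/
def TopHead (D : ArrowData α) (g : α) : Prop :=
  (∀ f, f ≠ g → D.hs f = D.hs g → D.hp g < D.hp f) ∧ ∀ f, D.ts f = D.hs g → D.hp g < D.tp f

/-- The head of `g` is the bottommost endpoint of its string. -/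
def BottomHead (D : ArrowData α) (g : α) : Prop :=
  (∀ f, f ≠ g → D.hs f = D.hs g → D.hp f < D.hp g) ∧ ∀ f, D.ts f = D.hs g → D.tp f < D.hp g

theorem IsPlanarConfig.insert_top [Finite α] [DecidableEq α]
    (c : D.IsPlanarConfig (K.erase (D.ts g)) t F)
    (htop : D.TopHead g) (hjK : D.ts g ∈ K) (hjt : D.ts g ≠ t) (hiK : D.hs g ∈ K)
    (hij : D.hs g ≠ D.ts g)
    (hadj : ∀ k ∈ K, min (D.hs g) (D.ts g) < k → ¬ k < max (D.hs g) (D.ts g)) :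
    g ∉ F ∧ D.IsPlanarConfig K t (insert g F) := by
  obtain ⟨c, h, hh⟩ := c
  have hgF : g ∉ F := fun hg => Finset.ne_of_mem_erase (c.ts_mem g hg) rfl
  obtain ⟨h', -, m, m'⟩ := exists_merged_height {g} F (Finset.disjoint_singleton_left.2 hgF) h h
  replace m' := m' g (Finset.mem_singleton_self g)
  refine ⟨hgF, c.insert_leaf hjK hjt hiK hij fun f _ => htop.2 f, h',
    hh.insert_leaf c hij m (fun f hf => (m' f hf).ne') ?_ ?_ (fun f hf _ => m' f hf)
      (fun k hk l₁ l₂ => (hadj k hk l₁ l₂).elim) (fun f hf _ _ => m' f hf)⟩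
  · intro f hf e
    exact iff_of_true (htop.1 f (fun e => hgF (e ▸ hf)) e) (m' f hf)
  · intro f hf e
    exact iff_of_false (htop.1 f (fun e => hgF (e ▸ hf)) e).not_gt (m' f hf).not_gt

theorem IsPlanarConfig.insert_bottom [Finite α] [DecidableEq α]
    (c : D.IsPlanarConfig (K.erase (D.ts g)) t F)
    (hbot : D.BottomHead g) (hjK : D.ts g ∈ K) (ht : D.hs g = t) (hiK : D.hs g ∈ K)
    (hij : D.hs g ≠ D.ts g)
    (hext : ∀ k ∈ K, (D.hs g < D.ts g → k ≤ D.ts g) ∧ (D.ts g < D.hs g → D.ts g ≤ k)) :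
    g ∉ F ∧ D.IsPlanarConfig K t (insert g F) := by
  obtain ⟨c, h, hh⟩ := c
  have hgF : g ∉ F := fun hg => Finset.ne_of_mem_erase (c.ts_mem g hg) rfl
  have hts : ∀ f ∈ F, D.ts f ≠ D.hs g := fun f hf => ht ▸ c.ts_ne f hf
  obtain ⟨h', m, -, m'⟩ := exists_merged_height F {g} (Finset.disjoint_singleton_right.2 hgF) h h
  replace m' := fun f hf => m' f hf g (Finset.mem_singleton_self g)
  refine ⟨hgF, c.insert_leaf hjK (ht ▸ hij.symm) hiK hij fun f hf e => (hts f hf e).elim, h',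
    hh.insert_leaf c hij m (fun f hf => (m' f hf).ne) ?_ ?_ (fun f hf e => (hts f hf e).elim)
      ?_ ?_⟩
  · intro f hf e
    exact iff_of_false (hbot.1 f (fun e => hgF (e ▸ hf)) e).not_gt (m' f hf).not_gt
  · intro f hf e
    exact iff_of_true (hbot.1 f (fun e => hgF (e ▸ hf)) e) (m' f hf)
  · intro k hk l₁ l₂
    obtain ⟨f, hf, e⟩ := c.surj k (Finset.mem_erase.2 ⟨by omega, hk⟩) (by omega)
    exact ⟨f, hf, e, m' f hf⟩
  · intro f hf l₁ l₂
    have a₁ := hext _ (Finset.mem_of_mem_erase (c.ts_mem f hf))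
    have a₂ := hext _ (Finset.mem_of_mem_erase (c.hs_mem f hf))
    omega

theorem IsPlanarConfig.adjacent_of_top [Finite α] (c : D.IsPlanarConfig K t F) (hg : g ∈ F)
    (htop : D.TopHead g) (hleaf : ∀ f ∈ F, D.hs f ≠ D.ts g) {k : ℕ} (hk : k ∈ K)
    (l₁ : min (D.hs g) (D.ts g) < k) : ¬ k < max (D.hs g) (D.ts g) := by
  obtain ⟨c, h, hh⟩ := c
  intro l₂
  obtain ⟨-, f, hf, l, e | e⟩ := c.reach_of_between hh hg hk l₁ l₂
  · have := htop.1 f (fun e => l.ne (e ▸ rfl)) e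
    have := (hh.order f hf g hg e).2 l
    linarith
  · exact hleaf f hf e

theorem exists_step_across {a b : ℕ} (r : ReflTransGen (D.Step F) a b) (x : ℕ) :
    (x < a → b ≤ x → ∃ f ∈ F, x < D.ts f ∧ D.hs f ≤ x) ∧
      (a < x → x ≤ b → ∃ f ∈ F, D.ts f < x ∧ x ≤ D.hs f) := by
  induction r using ReflTransGen.head_induction_on with
  | refl => omega
  | head s _ ih =>
    obtain ⟨f, hf, rfl, rfl⟩ := s
    constructor
    · intro l₁ l₂
      by_cases l : D.hs f ≤ x
      · exact ⟨f, hf, l₁, l⟩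
      · exact ih.1 (by omega) l₂
    · intro l₁ l₂
      by_cases l : x ≤ D.hs f
      · exact ⟨f, hf, l₁, l⟩
      · exact ih.2 (by omega) l₂

theorem IsPlanarConfig.extreme_of_bottom [Finite α] (c : D.IsPlanarConfig K t F) (hg : g ∈ F)
    (hbot : D.BottomHead g) (ht : D.hs g = t) (hleaf : ∀ f ∈ F, D.hs f ≠ D.ts g) {k : ℕ}
    (hk : k ∈ K) : (D.hs g < D.ts g → k ≤ D.ts g) ∧ (D.ts g < D.hs g → D.ts g ≤ k) := by
  obtain ⟨c, h, hh⟩ := c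
  subst ht
  have key : ∀ f ∈ F, min (D.hs f) (D.ts f) < D.ts g → D.ts g < max (D.hs f) (D.ts f) →
      (min (D.hs g) (D.ts g) < D.hs f ∧ D.hs f < max (D.hs g) (D.ts g) ∨ D.hs f = D.hs g ∨
        min (D.hs f) (D.ts f) < D.hs g ∧ D.hs g < max (D.hs f) (D.ts f)) → False := by
    intro f hf l₁ l₂ hc
    obtain ⟨f', hf', e, l⟩ := hh.cross f hf _ (c.ts_mem g hg) l₁ l₂
    obtain rfl := c.inj _ hf' _ hg e
    rcases hc with ⟨l₃, l₄⟩ | e | ⟨l₃, l₄⟩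
    · obtain ⟨f₁, hf₁, e₁, l'⟩ := hh.cross f' hf' _ (c.hs_mem f hf) l₃ l₄
      have := hh.lt f hf f₁ hf₁ e₁.symm
      linarith
    · have := hbot.1 f (by rintro rfl; omega) e
      have := (hh.order f hf f' hf' e).1 this
      linarith
    · obtain ⟨f₁, hf₁, e₁, l'⟩ := hh.cross f hf _ (c.hs_mem f' hf') l₃ l₄
      exact c.ts_ne f₁ hf₁ e₁
  have r := exists_step_across (c.reach hh hk) (D.ts g)
  constructor
  · intro l
    by_contra hlt
    obtain ⟨f, hf, l₁, l₂⟩ := r.1 (by omega) (by omega)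
    have := hleaf f hf
    exact key f hf (by omega) (by omega) (by omega)
  · intro l
    by_contra hlt
    obtain ⟨f, hf, l₁, l₂⟩ := r.2 (by omega) (by omega)
    have := hleaf f hf
    exact key f hf (by omega) (by omega) (by omega)

end leaf

section sums

/-- The contribution of `F` to the tree pairing. -/
def weight (D : ArrowData α) (F : Finset α) : ℤ :=
  ∏ f ∈ F, D.sign f * if D.ts f < D.hs f then -1 else 1

variable [Fintype α]

open Classical in
/-- The tree pairing as a sum over planar configurations. -/
noncomputable def treeSum (D : ArrowData α) (I : Finset ℕ) (t : ℕ) : ℤ :=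
  ∑ F : Finset α with D.IsPlanarConfig I t F, D.weight F

open Classical in
/-- The part of the tree pairing coming from configurations that contain `g`. -/
noncomputable def treeSumWith (D : ArrowData α) (I : Finset ℕ) (t : ℕ) (g : α) : ℤ :=
  ∑ F : Finset α with D.IsPlanarConfig I t F ∧ g ∈ F, D.weight F

open Classical in
/-- The part of the tree pairing coming from configurations in which `g` is tailed at a leaf. -/
noncomputable def treeSumLeaf (D : ArrowData α) (I : Finset ℕ) (t : ℕ) (g : α) : ℤ :=
  ∑ F : Finset α with D.IsPlanarConfig I t F ∧ g ∈ F ∧ ∀ f ∈ F, D.hs f ≠ D.ts g, D.weight F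

open Classical in
/-- The part of the tree pairing for the trunk string of the tail of `g` coming from
configurations with all heads on this string lying above the tail of `g`. -/
noncomputable def treeSumAbove (D : ArrowData α) (S : Finset ℕ) (g : α) : ℤ :=
  ∑ F : Finset α with D.IsPlanarConfig S (D.ts g) F ∧ ∀ f ∈ F, D.hs f = D.ts g → D.hp f < D.tp g,
    D.weight F

variable {g : α}

open Classical in
theorem sum_desc_eq (D : ArrowData α) (I : Finset ℕ) (t : ℕ) (g : α) {S : Finset ℕ}
    (hSI : S ⊆ I) (htS : t ∉ S) (hjS : D.ts g ∈ S)
    (hconv : ∀ a ∈ S, ∀ b ∈ S, ∀ k ∈ I, a < k → k < b → k ∈ S) :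
    ∑ F : Finset α with (D.IsPlanarConfig I t F ∧ g ∈ F) ∧ D.desc I F (D.ts g) = S, D.weight F =
      D.treeSumAbove S g * D.treeSumLeaf (collapse I S (D.ts g)) t g := by
  rw [treeSumAbove, treeSumLeaf, Finset.sum_mul_sum, ← Finset.sum_product']
  refine Finset.sum_bij'
    (fun F _ => ({f ∈ F | D.ts f ∈ S.erase (D.ts g)}, {f ∈ F | D.ts f ∉ S.erase (D.ts g)}))
    (fun p _ => p.1 ∪ p.2) ?_ ?_ ?_ ?_ ?_
  · intro F hF
    simp only [Finset.mem_filter, Finset.mem_univ, true_and] at hF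
    obtain ⟨⟨c, hg⟩, rfl⟩ := hF
    simp only [Finset.mem_product, Finset.mem_filter, Finset.mem_univ, true_and]
    refine ⟨⟨c.subtree hg, fun f hf e => c.1.above f hf.1 g hg e⟩, c.collapse hg,
      ⟨hg, Finset.notMem_erase _ _⟩, fun f hf e => c.hs_notMem_desc hg hf.1 hf.2 (e ▸ hjS)⟩
  · intro p hp
    simp only [Finset.mem_product, Finset.mem_filter, Finset.mem_univ, true_and] at hp ⊢
    obtain ⟨c, hd, -⟩ := hp.1.1.union hp.2.1 hp.2.2.1 hp.2.2.2 hp.1.2 hSI htS hjS hconv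
    exact ⟨⟨c, Finset.mem_union_right _ hp.2.2.1⟩, hd⟩
  · intro F _
    exact Finset.filter_union_filter_not_eq _ F
  · intro p hp
    simp only [Finset.mem_product, Finset.mem_filter, Finset.mem_univ, true_and] at hp
    obtain ⟨-, -, e₁, e₂⟩ := hp.1.1.union hp.2.1 hp.2.2.1 hp.2.2.2 hp.1.2 hSI htS hjS hconv
    exact Prod.ext e₁ e₂
  · intro F _
    exact (Finset.prod_filter_mul_prod_filter_not F _ _).symm

theorem IsPlanarConfig.desc_subset (c : D.IsPlanarConfig I t F) (hg : g ∈ F) :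
    D.desc I F (D.ts g) ⊆ I ∧ t ∉ D.desc I F (D.ts g) ∧ D.ts g ∈ D.desc I F (D.ts g) ∧
      ∀ a ∈ D.desc I F (D.ts g), ∀ b ∈ D.desc I F (D.ts g), ∀ k ∈ I, a < k → k < b →
        k ∈ D.desc I F (D.ts g) := by
  refine ⟨fun k hk => (mem_desc.1 hk).1, c.1.notMem_desc_trunk (c.1.ts_ne g hg),
    c.ts_mem_desc_self hg, fun a ha b hb k hk l₁ l₂ => mem_desc.2 ⟨hk, ?_⟩⟩
  obtain ⟨c, h, hh⟩ := c
  rcases le_total k (D.ts g) with l | l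
  · exact c.reach_convex hh (mem_desc.1 ha).2 hk (by omega) (by omega)
  · exact c.reach_convex hh (mem_desc.1 hb).2 hk (by omega) (by omega)

open Classical in
/-- A sum over configurations containing `g` lies in a submodule as soon as the contributions of
the possible subtrees on top of `g` do. -/
theorem sum_mem_of_desc (D : ArrowData α) (I : Finset ℕ) (t : ℕ) (g : α) (M : Submodule ℤ ℤ)
    (P : Finset ℕ → Prop)
    (H : ∀ S ⊆ I, t ∉ S → D.ts g ∈ S →
      (∀ a ∈ S, ∀ b ∈ S, ∀ k ∈ I, a < k → k < b → k ∈ S) → P S →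
      D.treeSumAbove S g * D.treeSumLeaf (ArrowData.collapse I S (D.ts g)) t g ∈ M) :
    ∑ F : Finset α with (D.IsPlanarConfig I t F ∧ g ∈ F) ∧ P (D.desc I F (D.ts g)),
      D.weight F ∈ M := by
  rw [← Finset.sum_fiberwise_of_maps_to (t := I.powerset) (g := fun F => D.desc I F (D.ts g))
    (fun F _ => Finset.mem_powerset.2 fun k hk => (mem_desc.1 hk).1)]
  refine Submodule.sum_mem _ fun S _ => ?_
  by_cases hS : S ⊆ I ∧ t ∉ S ∧ D.ts g ∈ S ∧
      (∀ a ∈ S, ∀ b ∈ S, ∀ k ∈ I, a < k → k < b → k ∈ S) ∧ P S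
  · obtain ⟨h₁, h₂, h₃, h₄, h₅⟩ := hS
    convert H S h₁ h₂ h₃ h₄ h₅ using 1
    rw [← sum_desc_eq D I t g h₁ h₂ h₃ h₄, Finset.filter_filter]
    refine Finset.sum_congr (Finset.filter_congr fun F _ => ?_) fun _ _ => rfl
    constructor
    · exact fun h => ⟨h.1.1, h.2⟩
    · rintro ⟨h, rfl⟩
      exact ⟨⟨h, h₅⟩, rfl⟩
  · convert M.zero_mem
    refine Finset.sum_eq_zero fun F hF => (hS ?_).elim
    simp only [Finset.mem_filter, Finset.mem_univ, true_and] at hF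
    obtain ⟨⟨⟨c, hg⟩, hP⟩, rfl⟩ := hF
    obtain ⟨h₁, h₂, h₃, h₄⟩ := c.desc_subset hg
    exact ⟨h₁, h₂, h₃, h₄, hP⟩

open Classical in
theorem treeSumLeaf_eq_of_insert (D : ArrowData α) {K : Finset ℕ}
    (H : ∀ F, D.IsPlanarConfig (K.erase (D.ts g)) t F →
      g ∉ F ∧ D.IsPlanarConfig K t (insert g F)) (hij : D.hs g ≠ D.ts g) :
    D.treeSumLeaf K t g =
      (D.sign g * if D.ts g < D.hs g then -1 else 1) * D.treeSum (K.erase (D.ts g)) t := by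
  rw [treeSumLeaf, treeSum, Finset.mul_sum]
  refine Finset.sum_bij' (fun F _ => F.erase g) (fun F _ => insert g F) ?_ ?_ ?_ ?_ ?_
  · intro F hF
    simp only [Finset.mem_filter, Finset.mem_univ, true_and] at hF ⊢
    exact hF.1.erase hF.2.1 hF.2.2
  · intro F hF
    simp only [Finset.mem_filter, Finset.mem_univ, true_and] at hF ⊢
    refine ⟨(H F hF).2, Finset.mem_insert_self _ _, ?_⟩
    rw [Finset.forall_mem_insert]
    exact ⟨hij, fun f hf => Finset.ne_of_mem_erase (hF.1.hs_mem f hf)⟩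
  · intro F hF
    simp only [Finset.mem_filter, Finset.mem_univ, true_and] at hF
    exact Finset.insert_erase hF.2.1
  · intro F hF
    simp only [Finset.mem_filter, Finset.mem_univ, true_and] at hF
    exact Finset.erase_insert (H F hF).1
  · intro F hF
    simp only [Finset.mem_filter, Finset.mem_univ, true_and] at hF
    exact (Finset.mul_prod_erase F _ hF.2.1).symm

theorem treeSumLeaf_top (D : ArrowData α) (K : Finset ℕ) (htop : D.TopHead g) :
    D.treeSumLeaf K t g = 0 ∨
      (D.hs g ≠ D.ts g ∧ D.hs g ∈ K ∧
        (∀ k ∈ K, min (D.hs g) (D.ts g) < k → ¬ k < max (D.hs g) (D.ts g)) ∧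
        ∃ c, D.treeSumLeaf K t g = c * D.treeSum (K.erase (D.ts g)) t) := by
  classical
  by_cases hF : ∃ F, D.IsPlanarConfig K t F ∧ g ∈ F ∧ ∀ f ∈ F, D.hs f ≠ D.ts g
  · obtain ⟨F, c, hg, hleaf⟩ := hF
    have hadj := fun k (hk : k ∈ K) => c.adjacent_of_top hg htop hleaf hk
    exact .inr ⟨hleaf g hg, c.1.hs_mem g hg, hadj, _, D.treeSumLeaf_eq_of_insert
      (fun F' c' => c'.insert_top htop (c.1.ts_mem g hg) (c.1.ts_ne g hg) (c.1.hs_mem g hg)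
        (hleaf g hg) hadj) (hleaf g hg)⟩
  · left
    refine Finset.sum_eq_zero fun F h => (hF ⟨F, ?_⟩).elim
    simpa using h

theorem treeSumLeaf_bottom (D : ArrowData α) (K : Finset ℕ) (hbot : D.BottomHead g) :
    D.treeSumLeaf K (D.hs g) g = 0 ∨
      (D.hs g ≠ D.ts g ∧
        (∀ k ∈ K, (D.hs g < D.ts g → k ≤ D.ts g) ∧ (D.ts g < D.hs g → D.ts g ≤ k)) ∧
        ∃ c, D.treeSumLeaf K (D.hs g) g = c * D.treeSum (K.erase (D.ts g)) (D.hs g)) := by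
  classical
  by_cases hF : ∃ F, D.IsPlanarConfig K (D.hs g) F ∧ g ∈ F ∧ ∀ f ∈ F, D.hs f ≠ D.ts g
  · obtain ⟨F, c, hg, hleaf⟩ := hF
    have hext := fun k (hk : k ∈ K) => c.extreme_of_bottom hg hbot rfl hleaf hk
    exact .inr ⟨hleaf g hg, hext, _, D.treeSumLeaf_eq_of_insert
      (fun F' c' => c'.insert_bottom hbot (c.1.ts_mem g hg) rfl (c.1.hs_mem g hg)
        (hleaf g hg) hext) (hleaf g hg)⟩
  · left
    refine Finset.sum_eq_zero fun F h => (hF ⟨F, ?_⟩).elim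
    simpa using h

theorem erase_collapse {S : Finset ℕ} {j : ℕ} (hj : j ∈ S) :
    (ArrowData.collapse I S j).erase j = I \ S := by
  ext k
  simp only [ArrowData.collapse, Finset.mem_erase, Finset.mem_sdiff]
  by_cases h : k = j
  · simp [h, hj]
  · simp [h]

end sums

theorem eq_Icc_of_convex {n j : ℕ} {S : Finset ℕ} (hS : S ⊆ Finset.Icc 1 n) (hj : j ∈ S)
    (hconv : ∀ a ∈ S, ∀ b ∈ S, ∀ k ∈ Finset.Icc 1 n, a < k → k < b → k ∈ S) :
    ∃ a b, 1 ≤ a ∧ a ≤ j ∧ j ≤ b ∧ b ≤ n ∧ S = Finset.Icc a b := by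
  have hne : S.Nonempty := ⟨j, hj⟩
  have ha := S.min'_mem hne
  have hb := S.max'_mem hne
  have ha' := Finset.mem_Icc.1 (hS ha)
  have hb' := Finset.mem_Icc.1 (hS hb)
  refine ⟨S.min' hne, S.max' hne, ha'.1, S.min'_le j hj, S.le_max' j hj, hb'.2, ?_⟩
  ext k
  rw [Finset.mem_Icc]
  refine ⟨fun hk => ⟨S.min'_le k hk, S.le_max' k hk⟩, fun ⟨l₁, l₂⟩ => ?_⟩
  rcases l₁.eq_or_lt with e | l₁
  · exact e ▸ ha
  rcases l₂.eq_or_lt with e | l₂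
  · exact e ▸ hb
  · exact hconv _ ha _ hb k (Finset.mem_Icc.2 ⟨by omega, by omega⟩) l₁ l₂

theorem Icc_sdiff_Icc {n a b : ℕ} (ha : 1 ≤ a) (hab : a ≤ b) (hb : b ≤ n) :
    Finset.Icc 1 n \ Finset.Icc a b = Finset.Icc 1 (a - 1) ∪ Finset.Icc (b + 1) n := by
  ext k
  simp only [Finset.mem_sdiff, Finset.mem_union, Finset.mem_Icc]
  omega

section basepoint

variable {n : ℕ} {g : α}

/-- The span of the tree pairings in the index families of the basepoint-change lemma that do not
involve the arrows tailed at the string `j`. -/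
noncomputable def basepointSpan [Fintype α] (D : ArrowData α) (n t j : ℕ) : Submodule ℤ ℤ :=
  Submodule.span ℤ {z | ∃ k ∈ Finset.Icc 1 n, ∃ J ∈ (if k = t then famT n t else famJ n k),
    (k = j ∨ j ∉ J) ∧ z = D.treeSum J k}

theorem treeSum_famT_mem [Fintype α] (D : ArrowData α) (ht : t ∈ Finset.Icc 1 n)
    {J : Finset ℕ} {j : ℕ}
    (hJ : J ∈ famT n t) (hj : j ∉ J) : D.treeSum J t ∈ D.basepointSpan n t j :=
  Submodule.subset_span ⟨t, ht, J, by simpa using hJ, .inr hj, rfl⟩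

theorem treeSum_famJ_mem [Fintype α] (D : ArrowData α) {j : ℕ} (hj : j ∈ Finset.Icc 1 n)
    {J : Finset ℕ}
    (hjt : j ≠ t) (hJ : J ∈ famJ n j) : D.treeSum J j ∈ D.basepointSpan n t j :=
  Submodule.subset_span ⟨j, hj, J, by simpa [hjt] using hJ, .inl rfl, rfl⟩

theorem treeSumWith_mem [Fintype α] (D : ArrowData α) (I : Finset ℕ) (t : ℕ) (g : α)
    (M : Submodule ℤ ℤ)
    (H : ∀ S ⊆ I, t ∉ S → D.ts g ∈ S →
      (∀ a ∈ S, ∀ b ∈ S, ∀ k ∈ I, a < k → k < b → k ∈ S) →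
      D.treeSumLeaf (ArrowData.collapse I S (D.ts g)) t g ∈ M) :
    D.treeSumWith I t g ∈ M := by
  have := sum_mem_of_desc D I t g M (fun _ => True)
    fun S h₁ h₂ h₃ h₄ _ => M.smul_mem _ (H S h₁ h₂ h₃ h₄)
  rw [treeSumWith]
  convert this using 3
  simp

theorem treeSumWith_mem_of_top [Fintype α] (D : ArrowData α) (ht : t ∈ Finset.Icc 1 n)
    (htop : D.TopHead g) :
    D.treeSumWith (Finset.Icc 1 n) t g ∈ D.basepointSpan n t (D.ts g) := by
  refine treeSumWith_mem D _ t g _ fun S hS htS hj hconv => ?_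
  rcases D.treeSumLeaf_top (t := t) (ArrowData.collapse (Finset.Icc 1 n) S (D.ts g)) htop with
    e | ⟨hij, hiK, hadj, c, e⟩
  · exact e ▸ Submodule.zero_mem _
  rw [e, erase_collapse hj]
  refine Submodule.smul_mem _ c (D.treeSum_famT_mem ht ?_ (by simp [hj]))
  obtain ⟨a, b, ha, haj, hjb, hb, rfl⟩ := eq_Icc_of_convex hS hj hconv
  rw [Icc_sdiff_Icc ha (haj.trans hjb) hb]
  have h₁ := hadj (a - 1)
  have h₂ := hadj (b + 1)
  simp only [ArrowData.collapse, Finset.mem_sdiff, Finset.mem_erase, Finset.mem_Icc] at *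
  rcases hij.lt_or_gt with l | l
  · refine .inl ⟨a - 1, b + 1, ?_⟩
    refine ⟨?_, ?_, ?_, ?_, ?_, rfl⟩ <;> omega
  · refine .inr ⟨b + 1, a - 1, ?_⟩
    refine ⟨?_, ?_, ?_, rfl⟩ <;> omega

theorem treeSumWith_mem_of_bottom [Fintype α] (D : ArrowData α) (ht : t ∈ Finset.Icc 1 n)
    (hbot : D.BottomHead g) :
    D.treeSumWith (Finset.Icc 1 n) t g ∈ D.basepointSpan n t (D.ts g) := by
  by_cases hgt : D.hs g = t
  swap
  · convert Submodule.zero_mem _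
    refine Finset.sum_eq_zero fun F hF => ?_
    simp only [Finset.mem_filter, Finset.mem_univ, true_and] at hF
    obtain ⟨f, hf, e⟩ := hF.1.1.surj _ (hF.1.1.hs_mem g hF.2) hgt
    exact ((hF.1.1.above g hF.2 f hf e.symm).not_gt (hbot.2 f e)).elim
  subst hgt
  refine treeSumWith_mem D _ _ g _ fun S hS htS hj hconv => ?_
  rcases D.treeSumLeaf_bottom (ArrowData.collapse (Finset.Icc 1 n) S (D.ts g)) hbot with
    e | ⟨hij, hext, c, e⟩
  · exact e ▸ Submodule.zero_mem _
  rw [e, erase_collapse hj]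
  refine Submodule.smul_mem _ c (D.treeSum_famT_mem ht ?_ (by simp [hj]))
  obtain ⟨a, b, ha, haj, hjb, hb, rfl⟩ := eq_Icc_of_convex hS hj hconv
  rw [Icc_sdiff_Icc ha (haj.trans hjb) hb]
  have h₁ := hext 1
  have h₂ := hext n
  simp only [ArrowData.collapse, Finset.mem_sdiff, Finset.mem_erase, Finset.mem_Icc] at *
  rcases hij.lt_or_gt with l | l
  · refine .inl ⟨a - 1, b + 1, ?_⟩
    refine ⟨?_, ?_, ?_, ?_, ?_, rfl⟩ <;> omega
  · refine .inr ⟨b + 1, a - 1, ?_⟩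
    refine ⟨?_, ?_, ?_, rfl⟩ <;> omega

/-- `D` and `D'` only differ in the positions of the endpoints in `S`, where the head of an arrow
`f` is `(f, true)` and its tail is `(f, false)`. -/
structure AgreeOff (D D' : ArrowData α) (S : Set (α × Bool)) : Prop where
  hs : D'.hs = D.hs
  ts : D'.ts = D.ts
  sign : D'.sign = D.sign
  order : ∀ f f', (f, true) ∉ S → (f', true) ∉ S → D.hs f = D.hs f' →
    (D.hp f < D.hp f' ↔ D'.hp f < D'.hp f')
  above : ∀ f f', (f, true) ∉ S → (f', false) ∉ S → D.hs f = D.ts f' →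
    (D.hp f < D.tp f' ↔ D'.hp f < D'.tp f')

theorem IsPlanarConfig.congr (c : D.IsPlanarConfig I t F) (hhs : D'.hs = D.hs)
    (hts : D'.ts = D.ts)
    (horder : ∀ f ∈ F, ∀ f' ∈ F, D.hs f = D.hs f' → (D.hp f < D.hp f' ↔ D'.hp f < D'.hp f'))
    (habove : ∀ f ∈ F, ∀ f' ∈ F, D.hs f = D.ts f' → D.hp f < D.tp f' → D'.hp f < D'.tp f') :
    D'.IsPlanarConfig I t F := by
  obtain ⟨c, h, hh⟩ := c
  refine ⟨⟨?_, ?_, ?_, ?_, ?_, ?_, ?_⟩, h, hh.inj, ?_, ?_, ?_⟩ <;> simp only [hhs, hts]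
  · exact c.ts_mem
  · exact c.ts_ne
  · exact c.hs_mem
  · exact c.hs_ne
  · exact c.surj
  · exact c.inj
  · exact fun f hf f' hf' e => habove f hf f' hf' e (c.above f hf f' hf' e)
  · exact fun f hf f' hf' e => (horder f hf f' hf' e).symm.trans (hh.order f hf f' hf' e)
  · exact hh.lt
  · exact hh.cross

theorem AgreeOff.symm {S : Set (α × Bool)} (s : AgreeOff D D' S) : AgreeOff D' D S where
  hs := s.hs.symm
  ts := s.ts.symm
  sign := s.sign.symm
  order f f' h h' e := (s.order f f' h h' (by rwa [s.hs] at e)).symm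
  above f f' h h' e := (s.above f f' h h' (by rwa [s.hs, s.ts] at e)).symm

theorem AgreeOff.weight_eq {S : Set (α × Bool)} (s : AgreeOff D D' S) (F : Finset α) :
    D'.weight F = D.weight F := by
  simp only [weight, s.hs, s.ts, s.sign]

theorem AgreeOff.isPlanarConfig {b : Bool} (s : AgreeOff D D' {(g, b)}) (hg : g ∉ F)
    (c : D.IsPlanarConfig I t F) : D'.IsPlanarConfig I t F := by
  have ne : ∀ f ∈ F, ∀ b', (f, b') ∉ ({(g, b)} : Set (α × Bool)) := by
    intro f hf b' e
    obtain rfl : f = g := congrArg Prod.fst (Set.mem_singleton_iff.1 e)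
    exact hg hf
  exact c.congr s.hs s.ts (fun f hf f' hf' => s.order f f' (ne f hf _) (ne f' hf' _))
    fun f hf f' hf' e => (s.above f f' (ne f hf _) (ne f' hf' _) e).1

theorem AgreeOff.isPlanarConfig_iff {b : Bool} (s : AgreeOff D D' {(g, b)}) (hg : g ∉ F) :
    D.IsPlanarConfig I t F ↔ D'.IsPlanarConfig I t F :=
  ⟨s.isPlanarConfig hg, s.symm.isPlanarConfig hg⟩

theorem IsConfig.notMem (c : D.IsConfig I t F) (h : t = D.ts g ∨ D.ts g ∉ I) : g ∉ F := by
  intro hg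
  rcases h with e | h
  · exact c.ts_ne g hg e.symm
  · exact h (c.ts_mem g hg)

theorem AgreeOff.treeSum_eq [Fintype α] {b : Bool} (s : AgreeOff D D' {(g, b)})
    (h : t = D.ts g ∨ D.ts g ∉ I) : D'.treeSum I t = D.treeSum I t := by
  classical
  refine Finset.sum_congr (Finset.filter_congr fun F _ => ⟨fun c => ?_, fun c => ?_⟩)
    fun F _ => s.weight_eq F
  · exact s.symm.isPlanarConfig (c.1.notMem (by rwa [s.ts])) c
  · exact s.isPlanarConfig (c.1.notMem h) c

theorem AgreeOff.basepointSpan_eq [Fintype α] {b : Bool} (s : AgreeOff D D' {(g, b)}) (n t : ℕ) :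
    D'.basepointSpan n t (D.ts g) = D.basepointSpan n t (D.ts g) := by
  unfold basepointSpan
  congr 1
  ext z
  constructor
  · rintro ⟨k, hk, J, hJ, h, rfl⟩
    exact ⟨k, hk, J, hJ, h, s.treeSum_eq h⟩
  · rintro ⟨k, hk, J, hJ, h, rfl⟩
    exact ⟨k, hk, J, hJ, h, (s.treeSum_eq h).symm⟩

open Classical in
theorem treeSum_eq_add [Fintype α] (D : ArrowData α) (I : Finset ℕ) (t : ℕ) (g : α) :
    D.treeSum I t = D.treeSumWith I t g +
      ∑ F : Finset α with D.IsPlanarConfig I t F ∧ g ∉ F, D.weight F := by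
  rw [treeSum, treeSumWith, ← Finset.filter_filter, ← Finset.filter_filter,
    Finset.sum_filter_add_sum_filter_not]

theorem AgreeOff.sub_mem_of_head [Fintype α] (s : AgreeOff D D' {(g, true)})
    (ht : t ∈ Finset.Icc 1 n) (htop : D.TopHead g) (hbot : D'.BottomHead g) :
    D.treeSum (Finset.Icc 1 n) t - D'.treeSum (Finset.Icc 1 n) t ∈
      D.basepointSpan n t (D.ts g) := by
  classical
  have e : ∑ F : Finset α with D'.IsPlanarConfig (Finset.Icc 1 n) t F ∧ g ∉ F, D'.weight F =
      ∑ F : Finset α with D.IsPlanarConfig (Finset.Icc 1 n) t F ∧ g ∉ F, D.weight F := by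
    refine Finset.sum_congr (Finset.filter_congr fun F _ => ?_) fun F _ => s.weight_eq F
    exact and_congr_left fun hg => (s.isPlanarConfig_iff hg).symm
  have h₁ := D.treeSumWith_mem_of_top ht htop
  have h₂ := D'.treeSumWith_mem_of_bottom ht hbot
  rw [s.ts, s.basepointSpan_eq] at h₂
  convert Submodule.sub_mem _ h₁ h₂ using 1
  rw [D.treeSum_eq_add _ t g, D'.treeSum_eq_add _ t g, e]
  ring

theorem IsPlanarConfig.desc_eq_singleton_iff (c : D.IsPlanarConfig I t F) (hg : g ∈ F) :
    D.desc I F (D.ts g) = {D.ts g} ↔ ∀ f ∈ F, D.hs f ≠ D.ts g := by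
  constructor
  · intro h f hf e
    have := c.1.ts_mem_desc (j := D.ts g) hf (e ▸ c.ts_mem_desc_self hg)
    rw [h, Finset.mem_singleton] at this
    exact c.1.hs_ne f hf (e.trans this.symm)
  · intro h
    ext k
    rw [mem_desc, Finset.mem_singleton]
    constructor
    · rintro ⟨-, r⟩
      rcases r.cases_tail with e | ⟨_, -, f, hf, -, e⟩
      · exact e.symm
      · exact (h f hf e).elim
    · rintro rfl
      exact ⟨c.1.ts_mem g hg, .refl⟩

theorem AgreeOff.sub_mem_of_tail [Fintype α] (s : AgreeOff D D' {(g, false)})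
    (htop : ∀ f, D.hs f = D.ts g → D.tp g < D.hp f)
    (hbot : ∀ f, D.hs f = D.ts g → D'.hp f < D'.tp g) :
    D.treeSum (Finset.Icc 1 n) t - D'.treeSum (Finset.Icc 1 n) t ∈
      D.basepointSpan n t (D.ts g) := by
  classical
  have key : ∀ F, D.IsPlanarConfig (Finset.Icc 1 n) t F ↔
      D'.IsPlanarConfig (Finset.Icc 1 n) t F ∧
        ¬ (g ∈ F ∧ D'.desc (Finset.Icc 1 n) F (D'.ts g) ≠ {D'.ts g}) := by
    intro F
    constructor
    · intro c
      have c' : D'.IsPlanarConfig (Finset.Icc 1 n) t F := by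
        refine c.congr s.hs s.ts (fun f _ f' _ => s.order f f' (by simp) (by simp)) ?_
        intro f hf f' hf' e l
        by_cases hg : f' = g
        · subst hg
          exact hbot f e
        · exact (s.above f f' (by simp) (by simp [hg]) e).1 l
      refine ⟨c', fun ⟨hg, hne⟩ => hne ((c'.desc_eq_singleton_iff hg).2 fun f hf e => ?_)⟩
      rw [s.hs, s.ts] at e
      exact (htop f e).not_gt (c.1.above f hf g hg e)
    · rintro ⟨c, hn⟩
      refine c.congr s.hs.symm s.ts.symm
        (fun f _ f' _ => s.symm.order f f' (by simp) (by simp)) fun f hf f' hf' e l => ?_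
      by_cases hg : f' = g
      · subst hg
        exact (hn ⟨hf', fun h => (c.desc_eq_singleton_iff hf').1 h f hf e⟩).elim
      · exact (s.symm.above f f' (by simp) (by simp [hg]) e).1 l
  have h := sum_mem_of_desc D' (Finset.Icc 1 n) t g (D.basepointSpan n t (D.ts g))
    (fun S => S ≠ {D'.ts g}) ?_
  · convert Submodule.neg_mem _ h using 1
    rw [treeSum, treeSum, Finset.filter_congr fun F _ => key F, ← Finset.filter_filter,
      ← Finset.sum_filter_add_sum_filter_not (Finset.univ.filter fun F =>
        D'.IsPlanarConfig (Finset.Icc 1 n) t F)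
        (fun F => g ∈ F ∧ D'.desc (Finset.Icc 1 n) F (D'.ts g) ≠ {D'.ts g}) D'.weight,
      Finset.filter_filter]
    simp only [← s.weight_eq, and_assoc, Finset.filter_filter]
    ring
  · intro S hS htS hj hconv hne
    have e : D'.treeSumAbove S g = D'.treeSum S (D'.ts g) := by
      refine Finset.sum_congr (Finset.filter_congr fun F _ => ?_) fun _ _ => rfl
      refine and_iff_left_of_imp fun c f hf e => hbot f ?_
      rwa [s.hs, s.ts] at e
    rw [e, mul_comm, ← s.basepointSpan_eq]
    refine Submodule.smul_mem _ _ ?_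
    rw [← s.ts]
    refine treeSum_famJ_mem D' (hS hj) (fun e => htS (e ▸ hj)) ?_
    obtain ⟨a, b, ha, haj, hjb, hb, rfl⟩ := eq_Icc_of_convex hS hj hconv
    refine ⟨a, b, ha, haj, hjb, hb, ?_, rfl⟩
    by_contra hab
    obtain rfl : a = D'.ts g := by omega
    obtain rfl : b = D'.ts g := by omega
    exact hne (Finset.Icc_self _)

end basepoint

variable {β : Type*}

section comp

/-- The arrow data with arrows relabelled along `ψ`. -/
def comp (D : ArrowData β) (ψ : α → β) : ArrowData α :=
  ⟨D.hs ∘ ψ, D.ts ∘ ψ, D.hp ∘ ψ, D.tp ∘ ψ, D.sign ∘ ψ⟩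

theorem IsPlanarConfig.map {D : ArrowData β} {ψ : α ≃ β} {I : Finset ℕ} {t : ℕ} {F : Finset α}
    (c : (D.comp ψ).IsPlanarConfig I t F) : D.IsPlanarConfig I t (F.map ψ.toEmbedding) := by
  obtain ⟨c, h, hh⟩ := c
  refine ⟨⟨?_, ?_, ?_, ?_, ?_, ?_, ?_⟩, h ∘ ψ.symm, ?_, ?_, ?_, ?_⟩ <;>
    try simp only [Finset.forall_mem_map, Equiv.coe_toEmbedding,
      Function.comp_apply, Equiv.symm_apply_apply, ψ.apply_eq_iff_eq]
  · exact c.ts_mem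
  · exact c.ts_ne
  · exact c.hs_mem
  · exact c.hs_ne
  · intro i hi hit
    obtain ⟨f, hf, e⟩ := c.surj i hi hit
    exact ⟨ψ f, Finset.mem_map_of_mem _ hf, e⟩
  · exact c.inj
  · exact c.above
  · exact hh.inj
  · exact hh.order
  · exact hh.lt
  · intro f hf k hk l₁ l₂
    obtain ⟨f', hf', e, l⟩ := hh.cross f hf k hk l₁ l₂
    exact ⟨ψ f', Finset.mem_map_of_mem _ hf', e, by rwa [ψ.symm_apply_apply]⟩

theorem treeSum_comp [Fintype α] [Fintype β] (D : ArrowData β) (ψ : α ≃ β) (I : Finset ℕ)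
    (t : ℕ) : (D.comp ψ).treeSum I t = D.treeSum I t := by
  classical
  refine Finset.sum_equiv ψ.finsetCongr (fun F => ?_) fun F _ => ?_
  · simp only [Finset.mem_filter, Finset.mem_univ, true_and, Equiv.finsetCongr_apply]
    refine ⟨IsPlanarConfig.map, fun c => ?_⟩
    have e : (D.comp ψ).comp ψ.symm = D := by
      simp [comp, Function.comp_assoc]
    rw [← e] at c
    convert c.map
    ext
    simp
  · rw [weight, weight, Equiv.finsetCongr_apply, Finset.prod_map]
    rfl

end comp

section treeOf

variable {s : Finset ℕ}

/-- The tree diagram with arrows indexed by `s` that is represented by `φ`. -/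
def treeOf (D : ArrowData α) (φ : s → α) : PreTree where
  par i := if h : i ∈ s then D.hs (φ ⟨i, h⟩) else i
  rk i :=
    if h : i ∈ s then
      (Finset.univ.filter fun b => D.hs (φ b) = D.hs (φ ⟨i, h⟩) ∧
        D.hp (φ b) < D.hp (φ ⟨i, h⟩)).card
    else 0

theorem treeOf_par (D : ArrowData α) (φ : s → α) (a : s) :
    (D.treeOf φ).par a = D.hs (φ a) := by
  simp [treeOf]

theorem treeOf_par_of_notMem (D : ArrowData α) (φ : s → α) {i : ℕ} (hi : i ∉ s) :
    (D.treeOf φ).par i = i := by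
  simp [treeOf, hi]

theorem treeOf_rk (D : ArrowData α) (φ : s → α) (a : s) :
    (D.treeOf φ).rk a = (Finset.univ.filter fun b =>
      D.hs (φ b) = D.hs (φ a) ∧ D.hp (φ b) < D.hp (φ a)).card := by
  simp [treeOf]

theorem treeOf_rk_of_notMem (D : ArrowData α) (φ : s → α) {i : ℕ} (hi : i ∉ s) :
    (D.treeOf φ).rk i = 0 := by
  simp [treeOf, hi]

theorem treeOf_rk_lt_rk_iff (D : ArrowData α) (φ : s → α) {a b : s}
    (h : D.hs (φ a) = D.hs (φ b)) :
    (D.treeOf φ).rk a < (D.treeOf φ).rk b ↔ D.hp (φ a) < D.hp (φ b) := by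
  rw [treeOf_rk, treeOf_rk, h]
  constructor
  · contrapose!
    refine fun l => Finset.card_le_card fun c => ?_
    simp only [Finset.mem_filter, Finset.mem_univ, true_and]
    exact fun hc => ⟨hc.1, hc.2.trans_le l⟩
  · refine fun l => Finset.card_lt_card (Finset.ssubset_iff_of_subset (fun c => ?_) |>.2 ⟨a, ?_⟩)
    · simp only [Finset.mem_filter, Finset.mem_univ, true_and]
      exact fun hc => ⟨hc.1, hc.2.trans l⟩
    · simp [h, l]

theorem card_sibling (D : ArrowData α) (φ : s → α) (i : ℕ) :
    (s.filter fun b => (D.treeOf φ).par b = i).card =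
      (Finset.univ.filter fun b => D.hs (φ b) = i).card := by
  refine (Finset.card_nbij Subtype.val (fun b hb => ?_) Subtype.val_injective.injOn
    fun b hb => ?_).symm
  · simpa [treeOf_par] using hb
  · simp only [Finset.coe_filter, Set.mem_ofPred_eq] at hb
    exact ⟨⟨b, hb.1⟩, by simpa [← treeOf_par] using hb.2, rfl⟩

theorem treeOf_rk_lt_card (D : ArrowData α) (φ : s → α) (a : s) :
    (D.treeOf φ).rk a < (s.filter fun b => (D.treeOf φ).par b = (D.treeOf φ).par a).card := by
  rw [card_sibling, treeOf_rk, treeOf_par]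
  refine Finset.card_lt_card (Finset.ssubset_iff_of_subset (fun c => ?_) |>.2 ⟨a, ?_⟩)
  · simp only [Finset.mem_filter, Finset.mem_univ, true_and]
    exact And.left
  · simp

end treeOf

end ArrowData

theorem card_filter_lt_eq_of_injOn {ι : Type*} {s : Finset ι} {r : ι → ℕ} (hr : Set.InjOn r s)
    (hlt : ∀ b ∈ s, r b < s.card) {i : ι} (hi : i ∈ s) :
    (s.filter fun b => r b < r i).card = r i := by
  have e : s.image r = Finset.range s.card := by
    refine Finset.eq_of_subset_of_card_le (fun k hk => ?_) ?_
    · obtain ⟨b, hb, rfl⟩ := Finset.mem_image.1 hk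
      exact Finset.mem_range.2 (hlt b hb)
    · rw [Finset.card_image_of_injOn hr, Finset.card_range]
  have e' : (s.filter fun b => r b < r i).image r = Finset.range (r i) := by
    have := hlt i hi
    rw [← Finset.filter_image (p := fun k => k < r i), e]
    ext k
    simp only [Finset.mem_filter, Finset.mem_range]
    omega
  rw [← Finset.card_image_of_injOn (hr.mono (Finset.coe_subset.2 (Finset.filter_subset _ _))), e',
    Finset.card_range]

namespace GaussDiagram

open ArrowData

variable {n : ℕ} {I : Finset ℕ} {t : ℕ}

/-- The arrow data underlying a Gauss diagram. -/
def data (G : GaussDiagram n) : ArrowData G.Arrow :=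
  ⟨G.hs, G.ts, G.hp, G.tp, G.sign⟩

theorem eq_treeOf (G : GaussDiagram n) {A : PreTree} {φ : {x // x ∈ I.erase t} → G.Arrow}
    (hA : A.IsTreeDiagram I t) (hφ : IsRep G I t A φ) : A = G.data.treeOf φ := by
  have hpar : A.par = (G.data.treeOf φ).par := by
    funext i
    by_cases hi : i ∈ I.erase t
    · exact (hφ.2.1 ⟨i, hi⟩).symm.trans (G.data.treeOf_par φ ⟨i, hi⟩).symm
    · rw [(hA.2.2 i hi).1, treeOf_par_of_notMem _ _ hi]
  have hrk : A.rk = (G.data.treeOf φ).rk := by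
    funext i
    by_cases hi : i ∈ I.erase t
    swap
    · rw [(hA.2.2 i hi).2, treeOf_rk_of_notMem _ _ hi]
    rw [treeOf_rk _ φ ⟨i, hi⟩]
    have := card_filter_lt_eq_of_injOn (r := fun b : {x // x ∈ I.erase t} => A.rk b)
      (s := Finset.univ.filter fun b => G.data.hs (φ b) = G.data.hs (φ ⟨i, hi⟩)) (i := ⟨i, hi⟩)
      ?_ ?_ (by simp)
    · rw [Finset.filter_filter] at this
      rw [← this]
      refine congrArg Finset.card (Finset.filter_congr fun b _ => and_congr_right fun e => ?_)
      refine hφ.2.2.2.1 b ⟨i, hi⟩ ?_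
      rw [← hφ.2.1, ← hφ.2.1]
      exact e
    · intro b hb c hc e
      simp only [Finset.coe_filter, Finset.mem_univ, true_and, Set.mem_ofPred_eq] at hb hc
      refine Subtype.ext (hA.2.1 b b.2 c c.2 ?_ e)
      rw [← hφ.2.1, ← hφ.2.1]
      exact hb.trans hc.symm
    · intro b hb
      simp only [Finset.mem_filter, Finset.mem_univ, true_and] at hb
      rw [← hb, ← card_sibling, ← treeOf_par, ← hpar]
      exact (hA.1 b b.2).2.2
  cases A
  simp only at hpar hrk
  rw [hpar, hrk]

theorem treeOf_mem_iff (G : GaussDiagram n) (φ : {x // x ∈ I.erase t} → G.Arrow) :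
    (G.data.treeOf φ ∈ TreeSet I t ∧ IsRep G I t (G.data.treeOf φ) φ) ↔
      (∀ a, G.ts (φ a) = a) ∧ G.data.IsPlanarConfig I t (Finset.univ.image φ) := by
  constructor
  · rintro ⟨⟨⟨h₁, h₂, h₃⟩, h, k₁, k₂, k₃, k₄⟩, r₁, r₂, r₃, r₄, r₅⟩
    have r₃' : ∀ a, G.data.ts (φ a) = a := r₃
    refine ⟨r₃, ⟨?_, ?_, ?_, ?_, ?_, ?_, ?_⟩, h ∘ G.data.ts, ?_, ?_, ?_, ?_⟩ <;>
      simp only [Finset.forall_mem_image, Finset.exists_mem_image, Finset.mem_univ, true_and,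
        true_implies, Function.comp_apply, r₃', ← treeOf_par]
    · exact fun a => Finset.mem_of_mem_erase a.2
    · exact fun a => Finset.ne_of_mem_erase a.2
    · exact fun a => (h₁ a a.2).1
    · exact fun a => (h₁ a a.2).2.1
    · exact fun i hi hit => ⟨⟨i, Finset.mem_erase.2 ⟨hit, hi⟩⟩, rfl⟩
    · exact fun a b e => congrArg φ (Subtype.ext e)
    · exact fun a b e => r₅ a b e
    · exact fun a b e => congrArg φ (Subtype.ext (k₁ a a.2 b b.2 e))
    · exact fun a b e => (r₄ a b e).symm.trans (k₂ a a.2 b b.2 e)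
    · exact fun a b e => k₃ a a.2 b b.2 e
    · intro a k hk l₁ l₂
      obtain ⟨hkt, hl⟩ := k₄ a a.2 k hk l₁ l₂
      exact ⟨⟨k, Finset.mem_erase.2 ⟨hkt, hk⟩⟩, rfl, hl⟩
  · rintro ⟨r, c, h, hh⟩
    have r' : ∀ a, G.data.ts (φ a) = a := r
    have m : ∀ a, φ a ∈ Finset.univ.image φ := fun a =>
      Finset.mem_image_of_mem _ (Finset.mem_univ a)
    have inj : Function.Injective φ := fun a b e => Subtype.ext (by rw [← r, ← r, e])
    have eq_of_rk : ∀ a b : {x // x ∈ I.erase t},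
        (G.data.treeOf φ).par a.1 = (G.data.treeOf φ).par b.1 →
        (G.data.treeOf φ).rk a.1 = (G.data.treeOf φ).rk b.1 → a = b := by
      intro a b e e'
      rw [treeOf_par, treeOf_par] at e
      have l₁ := treeOf_rk_lt_rk_iff G.data φ e
      have l₂ := treeOf_rk_lt_rk_iff G.data φ e.symm
      rw [hh.order _ (m a) _ (m b) e] at l₁
      rw [hh.order _ (m b) _ (m a) e.symm] at l₂
      refine inj (hh.inj _ (m a) _ (m b) (le_antisymm ?_ ?_))
      · exact not_lt.1 fun l => (l₂.2 l).ne' e'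
      · exact not_lt.1 fun l => (l₁.2 l).ne e'
    let h' : ℕ → ℚ := fun i => if hi : i ∈ I.erase t then h (φ ⟨i, hi⟩) else 0
    have hh' : ∀ a : {x // x ∈ I.erase t}, h' a = h (φ a) := fun a => dif_pos a.2
    refine ⟨⟨⟨fun i hi => ?_, fun i hi j hj e e' => ?_, fun i hi => ?_⟩, h', fun i hi j hj e => ?_,
      fun i hi j hj e => ?_, fun i hi j hj e => ?_, fun i hi k hk l₁ l₂ => ?_⟩,
      inj, fun a => (treeOf_par G.data φ a).symm, r, fun a b e => ?_, fun a b e => ?_⟩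
    · refine ⟨?_, ?_, treeOf_rk_lt_card _ φ ⟨i, hi⟩⟩
      · rw [treeOf_par _ φ ⟨i, hi⟩]
        exact c.hs_mem _ (m _)
      · rw [treeOf_par _ φ ⟨i, hi⟩]
        have := c.hs_ne _ (m ⟨i, hi⟩)
        rwa [r'] at this
    · exact congrArg Subtype.val (eq_of_rk ⟨i, hi⟩ ⟨j, hj⟩ e e')
    · exact ⟨treeOf_par_of_notMem _ _ hi, treeOf_rk_of_notMem _ _ hi⟩
    · rw [hh' ⟨i, hi⟩, hh' ⟨j, hj⟩] at e
      exact congrArg Subtype.val (inj (hh.inj _ (m _) _ (m _) e))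
    · rw [treeOf_par _ φ ⟨i, hi⟩, treeOf_par _ φ ⟨j, hj⟩] at e
      rw [hh' ⟨i, hi⟩, hh' ⟨j, hj⟩, treeOf_rk_lt_rk_iff G.data φ (a := ⟨i, hi⟩) (b := ⟨j, hj⟩) e]
      exact hh.order _ (m _) _ (m _) e
    · rw [treeOf_par _ φ ⟨i, hi⟩] at e
      rw [hh' ⟨i, hi⟩, hh' ⟨j, hj⟩]
      exact hh.lt _ (m _) _ (m _) (e.trans (r' ⟨j, hj⟩).symm)
    · rw [treeOf_par _ φ ⟨i, hi⟩] at l₁ l₂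
      have := hh.cross _ (m ⟨i, hi⟩) k hk
      rw [r'] at this
      obtain ⟨f, hf, e, l⟩ := this l₁ l₂
      obtain ⟨a, -, rfl⟩ := Finset.mem_image.1 hf
      rw [r'] at e
      subst e
      rw [hh', hh' ⟨i, hi⟩]
      exact ⟨Finset.ne_of_mem_erase a.2, l⟩
    · rw [treeOf_par, treeOf_par] at e
      exact treeOf_rk_lt_rk_iff G.data φ e
    · rw [treeOf_par] at e
      exact c.above _ (m a) _ (m b) (e.trans (r' b).symm)

theorem treeSign_mul_repSign (G : GaussDiagram n) (φ : {x // x ∈ I.erase t} → G.Arrow)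
    (hφ : ∀ a, G.ts (φ a) = a) :
    treeSign I t (G.data.treeOf φ) * repSign G φ = G.data.weight (Finset.univ.image φ) := by
  have inj : Function.Injective φ := fun a b e => Subtype.ext (by rw [← hφ, ← hφ, e])
  rw [weight, Finset.prod_image inj.injOn, Finset.prod_mul_distrib, mul_comm, repSign,
    finprod_eq_prod_of_fintype, treeSign]
  refine congrArg₂ _ rfl ?_
  rw [← Finset.prod_const, Finset.prod_filter, ← Finset.prod_coe_sort]
  refine Finset.prod_congr rfl fun a _ => ?_
  rw [treeOf_par]
  exact if_congr (by rw [show G.data.ts (φ a) = a from hφ a]) rfl rfl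

theorem Zpair_eq_treeSum (G : GaussDiagram n) (I : Finset ℕ) (t : ℕ) :
    Zpair G I t = G.data.treeSum I t := by
  classical
  let T : Finset PreTree :=
    Finset.univ.image fun φ : {x // x ∈ I.erase t} → G.Arrow => G.data.treeOf φ
  have hpair : ∀ A, pair G I t A = ∑ φ, if IsRep G I t A φ then repSign G φ else 0 := fun A => by
    rw [pair, finsum_eq_sum_of_fintype]
    exact Finset.sum_congr rfl fun φ _ => finsum_eq_if
  have hZ : Zpair G I t = ∑ A ∈ T, ∑ φ,
      if A ∈ TreeSet I t ∧ IsRep G I t A φ then treeSign I t A * repSign G φ else 0 := by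
    rw [Zpair, finsum_mem_def, finsum_eq_sum_of_support_subset
      (s := T)]
    · refine Finset.sum_congr rfl fun A _ => ?_
      by_cases hA : A ∈ TreeSet I t
      · simp [hA, hpair, Finset.mul_sum]
      · simp [hA]
    · intro A hA
      have hA' : A ∈ TreeSet I t := Set.mem_of_indicator_ne_zero hA
      rw [Function.mem_support, Set.indicator_of_mem hA', hpair] at hA
      obtain ⟨φ, -, hφ⟩ := Finset.exists_ne_zero_of_sum_ne_zero (right_ne_zero_of_mul hA)
      rw [ite_ne_right_iff] at hφ
      exact Finset.mem_image.2 ⟨φ, Finset.mem_univ _, (G.eq_treeOf hA'.1 hφ.1).symm⟩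
  have hsum : ∀ φ, (∑ A ∈ T,
      if A ∈ TreeSet I t ∧ IsRep G I t A φ then treeSign I t A * repSign G φ else 0) =
      if (∀ a, G.ts (φ a) = a) ∧ G.data.IsPlanarConfig I t (Finset.univ.image φ) then
        G.data.weight (Finset.univ.image φ) else 0 := by
    intro φ
    rw [Finset.sum_eq_single_of_mem (G.data.treeOf φ)
      (Finset.mem_image_of_mem _ (Finset.mem_univ φ))]
    · simp only [treeOf_mem_iff]
      split_ifs with h
      · exact G.treeSign_mul_repSign φ h.1
      · rfl
    · intro A _ hne
      exact if_neg fun h => hne (G.eq_treeOf h.1.1 h.2)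
  rw [hZ, Finset.sum_comm, Finset.sum_congr rfl fun φ _ => hsum φ, ← Finset.sum_filter, treeSum]
  refine Finset.sum_nbij (fun φ => Finset.univ.image φ) (fun φ hφ => ?_) (fun φ hφ χ hχ e => ?_)
    (fun F hF => ?_) fun φ _ => rfl
  · simp only [Finset.mem_filter, Finset.mem_univ, true_and] at hφ ⊢
    exact hφ.2
  · simp only [Finset.coe_filter, Finset.mem_univ, true_and, Set.mem_ofPred_eq] at hφ hχ
    funext a
    replace e : Finset.univ.image φ = Finset.univ.image χ := e
    have ha : φ a ∈ Finset.univ.image χ := e ▸ Finset.mem_image_of_mem _ (Finset.mem_univ a)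
    obtain ⟨b, -, hb⟩ := Finset.mem_image.1 ha
    obtain rfl : b = a := Subtype.ext (by rw [← hχ.1, ← hφ.1, hb])
    exact hb.symm
  · simp only [Finset.coe_filter, Finset.mem_univ, true_and, Set.mem_ofPred_eq] at hF
    choose φ hφF hφ using fun a : {x // x ∈ I.erase t} =>
      hF.1.surj a (Finset.mem_of_mem_erase a.2) (Finset.ne_of_mem_erase a.2)
    have e : Finset.univ.image φ = F := by
      ext f
      simp only [Finset.mem_image, Finset.mem_univ, true_and]
      constructor
      · rintro ⟨a, rfl⟩
        exact hφF a
      · exact fun hf => ⟨⟨G.data.ts f, Finset.mem_erase.2 ⟨hF.1.ts_ne f hf, hF.1.ts_mem f hf⟩⟩,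
          hF.1.inj _ (hφF _) _ hf (hφ _)⟩
    refine ⟨φ, ?_, e⟩
    simp only [Finset.coe_filter, Finset.mem_univ, true_and, Set.mem_ofPred_eq]
    exact ⟨hφ, e.symm ▸ hF⟩

end GaussDiagram

theorem famT_subset (n t : ℕ) (J : Finset ℕ) (hJ : J ∈ famT n t) : J ⊆ Finset.Icc 1 n := by
  intro x hx
  rcases hJ with ⟨i, k, h⟩ | ⟨i, k, h⟩ <;> obtain rfl : J = _ := by tauto
  all_goals
    simp only [Finset.mem_union, Finset.mem_Icc] at hx ⊢
    omega

theorem famJ_subset (n j : ℕ) (J : Finset ℕ) (hJ : J ∈ famJ n j) : J ⊆ Finset.Icc 1 n := by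
  obtain ⟨k, m, h₁, -, -, h₂, -, rfl⟩ := hJ
  exact Finset.Icc_subset_Icc h₁ h₂

/-- Every element of the span of finite families of integers is a linear combination of all their
members. -/
theorem exists_coeff_of_mem_span {ι : Type*} {s : Finset ℕ} {T : ℕ → Set ι}
    (hT : ∀ k, (T k).Finite) (x : ι → ℕ → ℤ) {z : ℤ}
    (hz : z ∈ Submodule.span ℤ {z | ∃ k ∈ s, ∃ J ∈ T k, z = x J k}) :
    ∃ a : ι → ℕ → ℤ, z = ∑ k ∈ s, ∑ᶠ J ∈ T k, a J k * x J k := by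
  classical
  have e : ∀ (a : ι → ℕ → ℤ) k, ∑ᶠ J ∈ T k, a J k * x J k =
      ∑ J ∈ (hT k).toFinset, a J k * x J k := fun a k => finsum_mem_eq_finite_toFinset_sum _ _
  simp only [e]
  induction hz using Submodule.span_induction with
  | mem z hz =>
    obtain ⟨k, hk, J, hJ, rfl⟩ := hz
    refine ⟨fun J' k' => if J' = J ∧ k' = k then 1 else 0, ?_⟩
    rw [Finset.sum_eq_single_of_mem k hk, Finset.sum_eq_single_of_mem J ((hT k).mem_toFinset.2 hJ)]
    · simp
    · intro J' _ h
      simp [h]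
    · intro k' _ h
      simp [h]
  | zero => exact ⟨0, by simp⟩
  | add z w _ _ hz hw =>
    obtain ⟨a, rfl⟩ := hz
    obtain ⟨b, rfl⟩ := hw
    exact ⟨a + b, by simp [add_mul, Finset.sum_add_distrib]⟩
  | smul c z _ hz =>
    obtain ⟨a, rfl⟩ := hz
    exact ⟨c • a, by simp [mul_assoc, Finset.mul_sum]⟩

namespace GaussDiagram

open ArrowData

variable {n : ℕ} {G G' : GaussDiagram n}

theorem agreeOff {ψ : G.Arrow → G'.Arrow} {S : Set (G.Arrow × Bool)} (hψ : ArrowMap G G' ψ)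
    (h : OrderPresOn G G' ψ S) : AgreeOff G.data (G'.data.comp ψ) S where
  hs := funext hψ.2.1
  ts := funext hψ.2.2
  sign := funext hψ.1
  order f f' hf hf' e := h (f, true) (f', true) hf hf' e
  above f f' hf hf' e := h (f, true) (f', false) hf hf' e

end GaussDiagram

theorem ArrowData.AgreeOff.sub_mem {α : Type*} [Fintype α] {D D' : ArrowData α} {g : α} {b : Bool}
    {n t : ℕ} (s : AgreeOff D D' {(g, b)}) (ht : t ∈ Finset.Icc 1 n)
    (h : ∀ e : α × Bool, e ≠ (g, b) →
      (if e.2 then D.hs e.1 else D.ts e.1) = (if b then D.hs g else D.ts g) →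
      (if b then D.hp g else D.tp g) < (if e.2 then D.hp e.1 else D.tp e.1) ∧
      (if e.2 then D'.hp e.1 else D'.tp e.1) < (if b then D'.hp g else D'.tp g)) :
    D.treeSum (Finset.Icc 1 n) t - D'.treeSum (Finset.Icc 1 n) t ∈
      D.basepointSpan n t (D.ts g) := by
  cases b
  · exact s.sub_mem_of_tail (fun f e => (h (f, true) (by simp) e).1)
      fun f e => (h (f, true) (by simp) e).2
  · refine s.sub_mem_of_head ht
      ⟨fun f hf e => (h (f, true) (by simp [hf]) e).1, fun f e => (h (f, false) (by simp) e).1⟩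
      ⟨fun f hf e => (h (f, true) (by simp [hf]) ?_).2, fun f e => (h (f, false) (by simp) ?_).2⟩
    · rwa [s.hs] at e
    · rwa [s.hs, s.ts] at e

theorem sub_mem_basepointSpan {n : ℕ} {G G' : GaussDiagram n} (hbp : BasepointMove G G') {t : ℕ}
    (ht : t ∈ Finset.Icc 1 n) :
    ∃ j, Zpair G (Finset.Icc 1 n) t - Zpair G' (Finset.Icc 1 n) t ∈
      G.data.basepointSpan n t j := by
  obtain ⟨ψ, hψ, ⟨g, b⟩, ho, h⟩ := hbp
  have s := GaussDiagram.agreeOff hψ ho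
  refine ⟨G.data.ts g, ?_⟩
  rw [G.Zpair_eq_treeSum, G'.Zpair_eq_treeSum, ← ArrowData.treeSum_comp _ ψ]
  rcases h with h | h
  · exact s.sub_mem ht h
  · rw [← neg_sub, ← s.basepointSpan_eq]
    refine Submodule.neg_mem _ ?_
    rw [← s.ts]
    refine s.symm.sub_mem ht fun e hne he => (h e hne ?_).symm
    rw [s.hs, s.ts] at he
    exact he


/-- **Basepoint-change lemma.**  If `G'` is obtained from the Gauss diagram
`G` on `n` strings by a single basepoint move, then for every `t ∈ {1,…,n}`
there are integers `a_{J;j}` with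
`⟨Z_{n;t},G⟩ − ⟨Z_{n;t},G'⟩ = Σ_{j=1}^{n} Σ_{J ∈ 𝓘_j} a_{J;j}·⟨Z_{J;j},G⟩`. -/
theorem basepoint_change (n : ℕ) (G G' : GaussDiagram n)
    (hbp : BasepointMove G G') (t : ℕ) (ht : t ∈ Finset.Icc 1 n) :
    ∃ a : Finset ℕ → ℕ → ℤ,
      Zpair G (Finset.Icc 1 n) t - Zpair G' (Finset.Icc 1 n) t =
        ∑ j ∈ Finset.Icc 1 n,
          ∑ᶠ J ∈ (if j = t then famT n t else famJ n j), a J j * Zpair G J j := by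
  obtain ⟨j, hj⟩ := sub_mem_basepointSpan hbp ht
  refine exists_coeff_of_mem_span (fun k => ?_) (Zpair G) (Submodule.span_mono ?_ hj)
  · refine (Finset.Icc 1 n).powerset.finite_toSet.subset fun J hJ => ?_
    rw [Finset.mem_coe, Finset.mem_powerset]
    split_ifs at hJ
    · exact famT_subset n t J hJ
    · exact famJ_subset n k J hJ
  · rintro z ⟨k, hk, J, hJ, -, rfl⟩
    exact ⟨k, hk, J, hJ, (G.Zpair_eq_treeSum J k).symm⟩
end

section
/- Invariance under the second Reidemeister move, diagram by diagram: if G' is obtained from a Gauss diagram G on n strings by an r2 move (insertion of a parallel pair g₊, g₋ of arrows of opposite signs with heads consecutive on some string i and tails consecutive on some string j), then ⟨A,G'⟩ = ⟨A,G⟩ for every planar tree diagram A ∈ 𝒜(I;t) with I ⊆ {1,…,n}. -/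
open scoped BigOperators

/-- The arrows `g` and `h` have consecutive heads on one string and consecutive
tails on one string. -/
structure IsAdjacentPair {n : ℕ} (G : GaussDiagram n) (g h : G.Arrow) : Prop where
  ne : g ≠ h
  hs_eq : G.hs g = G.hs h
  ts_eq : G.ts g = G.ts h
  head : Consecutive G (g, true) (h, true)
  tail : Consecutive G (g, false) (h, false)

theorem pair_eq_sum {n : ℕ} (G : GaussDiagram n) (I : Finset ℕ) (t : ℕ) (A : PreTree)
    [DecidablePred (IsRep G I t A)] :
    pair G I t A = ∑ φ, if IsRep G I t A φ then ∏ a, G.sign (φ a) else 0 := by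
  unfold pair
  rw [finsum_eq_sum_of_fintype]
  refine Finset.sum_congr rfl fun φ _ => ?_
  rw [finsum_eq_if, repSign, finprod_eq_prod_of_fintype]

/-- No endpoint separates two consecutive endpoints. -/
theorem Consecutive.lt_iff {n : ℕ} {G : GaussDiagram n} {e₁ e₂ e : G.Arrow × Bool}
    (hc : Consecutive G e₁ e₂) (hs : G.estr e₁ = G.estr e₂) (h₁ : e ≠ e₁) (h₂ : e ≠ e₂)
    (he : G.estr e = G.estr e₁) :
    (G.epos e < G.epos e₁ ↔ G.epos e < G.epos e₂) ∧
      (G.epos e₁ < G.epos e ↔ G.epos e₂ < G.epos e) := by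
  have hb := hc e h₁ h₂ he
  have d₁ : G.epos e ≠ G.epos e₁ := fun h => h₁ (G.distinct e e₁ he h)
  have d₂ : G.epos e ≠ G.epos e₂ := fun h => h₂ (G.distinct e e₂ (he.trans hs) h)
  rw [min_lt_iff, lt_max_iff] at hb
  grind

namespace IsAdjacentPair

variable {n : ℕ} {G : GaussDiagram n} {g h : G.Arrow}

theorem estr_eq (p : IsAdjacentPair G g h) (b : Bool) : G.estr (g, b) = G.estr (h, b) := by
  cases b
  · exact p.ts_eq
  · exact p.hs_eq

theorem consecutive (p : IsAdjacentPair G g h) (b : Bool) : Consecutive G (g, b) (h, b) := by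
  cases b
  · exact p.tail
  · exact p.head

theorem hs_swap (p : IsAdjacentPair G g h) (x : G.Arrow) :
    G.hs (Equiv.swap g h x) = G.hs x := by
  have := p.hs_eq
  rw [Equiv.swap_apply_def]
  grind

theorem ts_swap (p : IsAdjacentPair G g h) (x : G.Arrow) :
    G.ts (Equiv.swap g h x) = G.ts x := by
  have := p.ts_eq
  rw [Equiv.swap_apply_def]
  grind

theorem epos_swap_lt_iff (p : IsAdjacentPair G g h) {x y : G.Arrow} {b c : Bool}
    (hxy : G.ts x ≠ G.ts y) (hs : G.estr (x, b) = G.estr (y, c)) :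
    G.epos (Equiv.swap g h x, b) < G.epos (Equiv.swap g h y, c) ↔
      G.epos (x, b) < G.epos (y, c) := by
  have key : ∀ (z : G.Arrow) (b d : Bool), z ≠ g → z ≠ h → G.estr (z, d) = G.estr (g, b) →
      (G.epos (z, d) < G.epos (g, b) ↔ G.epos (z, d) < G.epos (h, b)) ∧
        (G.epos (g, b) < G.epos (z, d) ↔ G.epos (h, b) < G.epos (z, d)) :=
    fun z b d hg hh he => (p.consecutive b).lt_iff (p.estr_eq b)
      (fun e => hg (congrArg Prod.fst e)) (fun e => hh (congrArg Prod.fst e)) he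
  have hts := p.ts_eq
  have hb := p.estr_eq b
  have hc := p.estr_eq c
  rw [Equiv.swap_apply_def, Equiv.swap_apply_def]
  grind

theorem isRep_swap_comp (p : IsAdjacentPair G g h) {I : Finset ℕ} {t : ℕ} {A : PreTree}
    (hA : A.IsTreeDiagram I t) {φ : {x // x ∈ I.erase t} → G.Arrow} (hφ : IsRep G I t A φ) :
    IsRep G I t A (Equiv.swap g h ∘ φ) := by
  obtain ⟨hinj, hhs, hts, hord, htail⟩ := hφ
  have hne : ∀ a a', a ≠ a' → G.ts (φ a) ≠ G.ts (φ a') := fun a a' haa' => by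
    rw [hts, hts]
    exact fun e => haa' (Subtype.ext e)
  refine ⟨(Equiv.injective _).comp hinj, fun a => (p.hs_swap _).trans (hhs a),
    fun a => (p.ts_swap _).trans (hts a), fun a a' haa' => ?_, fun a a' haa' => ?_⟩
  · obtain rfl | hn := eq_or_ne a a'
    · simp
    · exact (hord a a' haa').trans (p.epos_swap_lt_iff (b := true) (c := true) (hne a a' hn)
        ((hhs a).trans (haa'.trans (hhs a').symm))).symm
  · have hn : a ≠ a' := fun e => (hA.1 a.1 a.2).2.1 (haa'.trans (congrArg Subtype.val e.symm))
    exact (p.epos_swap_lt_iff (b := true) (c := false) (hne a a' hn)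
      ((hhs a).trans (haa'.trans (hts a').symm))).mpr (htail a a' haa')

theorem isRep_swap_comp_iff (p : IsAdjacentPair G g h) {I : Finset ℕ} {t : ℕ} {A : PreTree}
    (hA : A.IsTreeDiagram I t) {φ : {x // x ∈ I.erase t} → G.Arrow} :
    IsRep G I t A (Equiv.swap g h ∘ φ) ↔ IsRep G I t A φ := by
  refine ⟨fun hφ => ?_, p.isRep_swap_comp hA⟩
  have hswap := p.isRep_swap_comp hA hφ
  rwa [← Function.comp_assoc, ← Equiv.coe_trans, Equiv.swap_swap, Equiv.coe_refl,
    Function.id_comp] at hswap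

/-- Exactly one arrow of a representation meeting an adjacent pair lies in it. -/
theorem prod_sign_swap (p : IsAdjacentPair G g h) (hsign : G.sign g = -G.sign h)
    {I : Finset ℕ} {t : ℕ} {A : PreTree} {φ : {x // x ∈ I.erase t} → G.Arrow}
    (hφ : IsRep G I t A φ) {a : {x // x ∈ I.erase t}} (ha : φ a = g ∨ φ a = h) :
    ∏ b, G.sign (Equiv.swap g h (φ b)) = -∏ b, G.sign (φ b) := by
  have hts := hφ.2.2.1
  rw [← Finset.mul_prod_erase _ _ (Finset.mem_univ a),
    ← Finset.mul_prod_erase _ (fun b => G.sign (φ b)) (Finset.mem_univ a), ← neg_mul]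
  congr 1
  · rcases ha with ha | ha <;> simp [ha, hsign]
  · refine Finset.prod_congr rfl fun b hb => ?_
    have hab : G.ts (φ b) ≠ G.ts (φ a) := by
      rw [hts, hts]
      exact fun e => Finset.ne_of_mem_erase hb (Subtype.ext e)
    have := p.ts_eq
    rw [Equiv.swap_apply_of_ne_of_ne] <;> grind

end IsAdjacentPair

theorem isRep_comp_iff {n : ℕ} {G G' : GaussDiagram n} {ψ : G.Arrow → G'.Arrow}
    (hinj : Function.Injective ψ) (hmap : ArrowMap G G' ψ) (hord : OrderPresOn G G' ψ ∅)
    {I : Finset ℕ} {t : ℕ} {A : PreTree} {φ : {x // x ∈ I.erase t} → G.Arrow} :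
    IsRep G' I t A (ψ ∘ φ) ↔ IsRep G I t A φ := by
  unfold IsRep
  simp only [Function.comp_apply, hmap.2.1, hmap.2.2, hinj.of_comp_iff]
  refine and_congr_right fun _ => and_congr_right fun hhs => and_congr_right fun hts =>
    and_congr (forall₃_congr fun a a' haa' => ?_) (forall₃_congr fun a a' haa' => ?_)
  · exact iff_congr Iff.rfl (hord (φ a, true) (φ a', true) (Set.notMem_empty _)
      (Set.notMem_empty _) ((hhs a).trans (haa'.trans (hhs a').symm))).symm
  · exact (hord (φ a, true) (φ a', false) (Set.notMem_empty _)
      (Set.notMem_empty _) ((hhs a).trans (haa'.trans (hts a').symm))).symm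

/-- **Invariance under the second Reidemeister move, diagram by diagram.**
If `G'` is obtained from the Gauss diagram `G` on `n` strings by insertion of
a parallel pair of arrows of opposite signs (an r2 move), then
`⟨A,G'⟩ = ⟨A,G⟩` for every planar tree diagram `A ∈ 𝒜(I;t)` with
`I ⊆ {1,…,n}`. -/
theorem r2_invariance (n : ℕ) (G G' : GaussDiagram n) (hmove : R2Ins G G')
    (I : Finset ℕ) (hI : I ⊆ Finset.Icc 1 n) (t : ℕ) (ht : t ∈ I)
    (A : PreTree) (hA : A ∈ TreeSet I t) :
    pair G' I t A = pair G I t A := by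
  classical
  obtain ⟨ψ, g, h, hinj, hmap, hord, hne, hψ, hsurj, hsign, hhs, hts, hhead, htail, -⟩ := hmove
  have p : IsAdjacentPair G' g h := ⟨hne, hhs, hts, hhead, htail⟩
  rw [pair_eq_sum, pair_eq_sum,
    ← Finset.sum_filter_add_sum_filter_not _ (fun φ => ∃ a, φ a = g ∨ φ a = h)]
  have hcancel : (∑ φ with ∃ a, φ a = g ∨ φ a = h,
      if IsRep G' I t A φ then ∏ a, G'.sign (φ a) else 0) = 0 := by
    have hswap : ∀ x, (Equiv.swap g h x = g ∨ Equiv.swap g h x = h) ↔ (x = g ∨ x = h) := by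
      intro x
      rw [Equiv.swap_apply_eq_iff, Equiv.swap_apply_eq_iff, Equiv.swap_apply_left,
        Equiv.swap_apply_right, or_comm]
    refine Finset.sum_involution (fun φ _ => Equiv.swap g h ∘ φ) ?_ ?_ ?_ ?_
    · intro φ hφ
      obtain ⟨a, ha⟩ := (Finset.mem_filter.mp hφ).2
      by_cases hrep : IsRep G' I t A φ
      · simp only [p.isRep_swap_comp_iff hA.1, hrep, if_true, Function.comp_apply,
          p.prod_sign_swap hsign hrep ha, add_neg_cancel]
      · simp only [p.isRep_swap_comp_iff hA.1, hrep, if_false, add_zero]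
    · intro φ hφ _ heq
      obtain ⟨a, ha⟩ := (Finset.mem_filter.mp hφ).2
      have hfix : Equiv.swap g h (φ a) = φ a := congrFun heq a
      rcases ha with ha | ha <;> simp [ha, hne, hne.symm] at hfix
    · intro φ hφ
      simpa [hswap] using hφ
    · intro φ _
      funext a
      simp
  rw [hcancel, zero_add]
  symm
  refine Finset.sum_bij (fun φ _ => ψ ∘ φ) ?_ ?_ ?_ ?_
  · intro φ _
    simp [hψ]
  · exact fun _ _ _ _ heq => hinj.comp_left heq
  · intro φ hφ
    simp only [Finset.mem_filter, Finset.mem_univ, true_and, not_exists, not_or] at hφ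
    choose χ hχ using fun a => hsurj (φ a) (hφ a).1 (hφ a).2
    exact ⟨χ, Finset.mem_univ _, funext hχ⟩
  · intro φ _
    simp only [isRep_comp_iff hinj hmap hord, Function.comp_apply, hmap.1]
end

section
/- Recursive decomposition of planar tree diagrams: let n ≥ 2 and A ∈ 𝒜(n;r). Then there exists k ∈ {1,…,n−1} and a planar tree diagram A' (possibly the empty diagram when n = 2) such that either A = A' ≺_k e, with A' ∈ 𝒜(n−1;r) if k ≥ r and A' ∈ 𝒜(n−1;r−1) if k < r, or A = A' ≺_k ē, with A' ∈ 𝒜(n−1;r) if k > r and A' ∈ 𝒜(n−1;r−1) if k ≤ r. -/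
open scoped BigOperators

/-- The increasing enumeration of `ℕ` with the value `a` left out. -/
def skip (a q : ℕ) : ℕ := if q < a then q else q + 1

/-- The left inverse of `skip a`. -/
def unskip (a x : ℕ) : ℕ := if x < a then x else x - 1

theorem unskip_skip (a q : ℕ) : unskip a (skip a q) = q := by
  unfold skip unskip; split_ifs <;> omega

theorem skip_unskip {a x : ℕ} (h : x ≠ a) : skip a (unskip a x) = x := by
  unfold skip unskip; split_ifs <;> omega

theorem skip_ne (a q : ℕ) : skip a q ≠ a := by
  unfold skip; split_ifs <;> omega

theorem skip_strictMono (a : ℕ) : StrictMono (skip a) := by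
  intro p q h
  unfold skip; split_ifs <;> omega

theorem skip_mem_Icc {n a : ℕ} (ha : a ∈ Finset.Icc 1 n) (q : ℕ) :
    skip a q ∈ Finset.Icc 1 n ↔ q ∈ Finset.Icc 1 (n - 1) := by
  rw [Finset.mem_Icc] at *
  unfold skip; split_ifs <;> rw [Finset.mem_Icc] <;> omega

theorem skip_mem_Icc_erase {n a r : ℕ} (ha : a ∈ (Finset.Icc 1 n).erase r) (q : ℕ) :
    skip a q ∈ (Finset.Icc 1 n).erase r ↔
      q ∈ (Finset.Icc 1 (n - 1)).erase (unskip a r) := by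
  obtain ⟨har, ha⟩ := Finset.mem_erase.mp ha
  rw [Finset.mem_erase, Finset.mem_erase, skip_mem_Icc ha]
  refine and_congr_left' (not_congr ⟨?_, ?_⟩)
  · rintro rfl; rw [unskip_skip]
  · rintro rfl; rw [skip_unskip har.symm]

namespace PreTree

/-- Delete the string `a`, assumed to carry no arrowhead and to have its tail joined to the
topmost arrowhead of its parent string, and renumber the remaining strings. -/
def deleteString (a : ℕ) (A : PreTree) : PreTree where
  par q := unskip a (A.par (skip a q))
  rk q :=
    if A.par (skip a q) = A.par a ∧ skip a q ≠ A.par a then A.rk (skip a q) - 1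
    else A.rk (skip a q)

theorem deleteString_par_eq_iff {a : ℕ} {A : PreTree} (hleaf : ∀ i, A.par i ≠ a) (p q : ℕ) :
    (A.deleteString a).par p = (A.deleteString a).par q ↔
      A.par (skip a p) = A.par (skip a q) := by
  refine ⟨fun h => ?_, fun h => by simp only [deleteString, h]⟩
  rw [← skip_unskip (hleaf (skip a p)), ← skip_unskip (hleaf (skip a q))]
  exact congrArg (skip a) h

theorem IsTreeDiagram.rk_pos {I : Finset ℕ} {r a i : ℕ} {A : PreTree}
    (hA : A.IsTreeDiagram I r) (ha : a ∈ I.erase r) (hrk : A.rk a = 0)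
    (hi : i ∈ I.erase r) (hpar : A.par i = A.par a) (hne : i ≠ a) : 0 < A.rk i :=
  Nat.pos_of_ne_zero fun h => hne (hA.2.1 i hi a ha hpar (h.trans hrk.symm))

theorem IsTreeDiagram.rk_deleteString {I : Finset ℕ} {r a q : ℕ} {A : PreTree}
    (hA : A.IsTreeDiagram I r) (hq : skip a q ∈ I.erase r) :
    (A.deleteString a).rk q =
      if A.par (skip a q) = A.par a then A.rk (skip a q) - 1 else A.rk (skip a q) := by
  have h := (hA.1 _ hq).2.1
  have : (A.par (skip a q) = A.par a ∧ skip a q ≠ A.par a) ↔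
      A.par (skip a q) = A.par a :=
    ⟨And.left, fun h' => ⟨h', fun h'' => h (h'.trans h''.symm)⟩⟩
  simp only [deleteString, this]

theorem card_children_deleteString {n r a : ℕ} {A : PreTree}
    (ha : a ∈ (Finset.Icc 1 n).erase r) (hleaf : ∀ i, A.par i ≠ a) (q : ℕ) :
    (((Finset.Icc 1 (n - 1)).erase (unskip a r)).filter
        fun b => (A.deleteString a).par b = (A.deleteString a).par q).card =
      ((((Finset.Icc 1 n).erase r).filter
        fun b => A.par b = A.par (skip a q)).erase a).card := by
  rw [← Finset.card_image_of_injective _ (skip_strictMono a).injective]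
  congr 1
  ext x
  simp only [Finset.mem_image, Finset.mem_filter, deleteString_par_eq_iff hleaf,
    ← skip_mem_Icc_erase ha, Finset.mem_erase (a := x) (b := a)]
  constructor
  · rintro ⟨b, hb, rfl⟩
    exact ⟨skip_ne a b, hb⟩
  · rintro ⟨hx, h⟩
    exact ⟨unskip a x, by rwa [skip_unskip hx], skip_unskip hx⟩

theorem IsTreeDiagram.deleteString {n r a : ℕ} {A : PreTree}
    (hA : A.IsTreeDiagram (Finset.Icc 1 n) r) (ha : a ∈ (Finset.Icc 1 n).erase r)
    (hrk : A.rk a = 0) (hleaf : ∀ i, A.par i ≠ a) :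
    (A.deleteString a).IsTreeDiagram (Finset.Icc 1 (n - 1)) (unskip a r) := by
  have ha' := Finset.mem_of_mem_erase ha
  refine ⟨fun q hq => ?_, fun q hq p hp hpar hrk' => ?_, fun q hq => ?_⟩
  · rw [← skip_mem_Icc_erase ha] at hq
    obtain ⟨hI, hne, hlt⟩ := hA.1 _ hq
    refine ⟨?_, fun h => hne ?_, ?_⟩
    · rw [← skip_mem_Icc ha']
      simpa only [PreTree.deleteString, skip_unskip (hleaf _)] using hI
    · rw [← skip_unskip (hleaf (skip a q))]
      exact congrArg (skip a) h
    · rw [card_children_deleteString ha hleaf, hA.rk_deleteString hq]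
      split_ifs with h
      · have hpos := hA.rk_pos ha hrk hq h (skip_ne a q)
        rw [Finset.card_erase_of_mem (Finset.mem_filter.mpr ⟨ha, h.symm⟩)]
        omega
      · rwa [Finset.erase_eq_of_notMem]
        exact fun h' => h (Finset.mem_filter.mp h').2.symm
  · rw [← skip_mem_Icc_erase ha] at hq hp
    rw [deleteString_par_eq_iff hleaf] at hpar
    rw [hA.rk_deleteString hq, hA.rk_deleteString hp, hpar] at hrk'
    refine (skip_strictMono a).injective (hA.2.1 _ hq _ hp hpar ?_)
    split_ifs at hrk' with h
    · have := hA.rk_pos ha hrk hq (hpar.trans h) (skip_ne a q)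
      have := hA.rk_pos ha hrk hp h (skip_ne a p)
      omega
    · exact hrk'
  · rw [← skip_mem_Icc_erase ha] at hq
    obtain ⟨h1, h2⟩ := hA.2.2 _ hq
    simp [PreTree.deleteString, h1, h2, unskip_skip]

theorem deleteString_isPlanar {n r a : ℕ} {A : PreTree}
    (hA : A.IsTreeDiagram (Finset.Icc 1 n) r) (hpl : A.IsPlanar (Finset.Icc 1 n) r)
    (ha : a ∈ (Finset.Icc 1 n).erase r) (hrk : A.rk a = 0) (hleaf : ∀ i, A.par i ≠ a) :
    (A.deleteString a).IsPlanar (Finset.Icc 1 (n - 1)) (unskip a r) := by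
  have ha' := Finset.mem_of_mem_erase ha
  have hpar (q : ℕ) : skip a ((A.deleteString a).par q) = A.par (skip a q) :=
    skip_unskip (hleaf _)
  obtain ⟨h, hinj, hord, htail, hcross⟩ := hpl
  refine ⟨h ∘ skip a, fun q hq p hp e => ?_, fun q hq p hp e => ?_, fun q hq p hp e => ?_,
    fun b hb c hc h1 h2 => ?_⟩
  · rw [← skip_mem_Icc_erase ha] at hq hp
    exact (skip_strictMono a).injective (hinj _ hq _ hp e)
  · rw [← skip_mem_Icc_erase ha] at hq hp
    rw [deleteString_par_eq_iff hleaf] at e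
    rw [hA.rk_deleteString hq, hA.rk_deleteString hp, Function.comp, Function.comp,
      ← hord _ hq _ hp e, e]
    split_ifs with h'
    · have := hA.rk_pos ha hrk hq (e.trans h') (skip_ne a q)
      have := hA.rk_pos ha hrk hp h' (skip_ne a p)
      omega
    · rfl
  · rw [← skip_mem_Icc_erase ha] at hq hp
    exact htail _ hq _ hp (by rw [← hpar, e])
  · rw [← skip_mem_Icc_erase ha] at hb
    rw [← skip_mem_Icc ha'] at hc
    have hmono := skip_strictMono a
    have := hcross _ hb _ hc
      (by rw [← hpar, ← hmono.monotone.map_min]; exact hmono h1)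
      (by rw [← hpar, ← hmono.monotone.map_max]; exact hmono h2)
    refine ⟨?_, this.2⟩
    rintro rfl
    exact this.1 (skip_unskip (Finset.ne_of_mem_erase ha).symm)

theorem deleteString_mem_treeSetFull {n r a : ℕ} {A : PreTree} (hA : A ∈ TreeSetFull n r)
    (ha : a ∈ (Finset.Icc 1 n).erase r) (hrk : A.rk a = 0) (hleaf : ∀ i, A.par i ≠ a) :
    A.deleteString a ∈ TreeSetFull (n - 1) (unskip a r) :=
  ⟨hA.1.deleteString ha hrk hleaf, deleteString_isPlanar hA.1 hA.2 ha hrk hleaf⟩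

/-- On every string carrying an arrowhead, some arrowhead is topmost. -/
theorem IsTreeDiagram.exists_rk_eq_zero {I : Finset ℕ} {r a : ℕ} {A : PreTree}
    (hA : A.IsTreeDiagram I r) (ha : a ∈ I.erase r) :
    ∃ b ∈ I.erase r, A.par b = A.par a ∧ A.rk b = 0 := by
  set S := (I.erase r).filter fun b => A.par b = A.par a with hS
  have hpos : 0 < S.card := Finset.card_pos.mpr ⟨a, Finset.mem_filter.mpr ⟨ha, rfl⟩⟩
  obtain ⟨b, hb, h0⟩ := Finset.surj_on_of_inj_on_of_card_le
    (s := S) (t := Finset.range S.card) (fun b _ => A.rk b)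
    (fun b hb => by
      obtain ⟨hb, hpar⟩ := Finset.mem_filter.mp hb
      have := (hA.1 b hb).2.2
      rw [hpar] at this
      exact Finset.mem_range.mpr this)
    (fun b c hb hc h => by
      obtain ⟨hb, hbpar⟩ := Finset.mem_filter.mp hb
      obtain ⟨hc, hcpar⟩ := Finset.mem_filter.mp hc
      exact hA.2.1 b hb c hc (hbpar.trans hcpar.symm) h)
    (by simp) 0 (Finset.mem_range.mpr hpos)
  obtain ⟨hb, hpar⟩ := Finset.mem_filter.mp hb
  exact ⟨b, hb, hpar, h0.symm⟩

/-- A planar tree diagram on at least two strings has an arrow joining neighbouring strings,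
topmost on its parent string and whose tail string carries no arrowhead. -/
theorem exists_top_leaf {n r : ℕ} {A : PreTree} (hn : 2 ≤ n) (hA : A ∈ TreeSetFull n r) :
    ∃ a ∈ (Finset.Icc 1 n).erase r, A.rk a = 0 ∧ (∀ i, A.par i ≠ a) ∧
      (A.par a + 1 = a ∨ A.par a = a + 1) := by
  obtain ⟨hT, h, hinj, hord, htail, hcross⟩ := hA
  have hne : ((Finset.Icc 1 n).erase r).Nonempty := by
    rw [← Finset.card_pos]
    have := Finset.pred_card_le_card_erase (s := Finset.Icc 1 n) (a := r)
    rw [Nat.card_Icc] at this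
    omega
  obtain ⟨a, ha, hmin⟩ := Finset.exists_min_image _ h hne
  have hnone (c : ℕ) (hc : c ∈ Finset.Icc 1 n) (h1 : min (A.par a) a < c)
      (h2 : c < max (A.par a) a) : False := by
    obtain ⟨hcr, hlt⟩ := hcross a ha c hc h1 h2
    exact (hmin c (Finset.mem_erase.mpr ⟨hcr, hc⟩)).not_gt hlt
  obtain ⟨hpar, hpar_ne, -⟩ := hT.1 a ha
  have haI := Finset.mem_Icc.mp (Finset.mem_of_mem_erase ha)
  rw [Finset.mem_Icc] at hpar
  refine ⟨a, ha, ?_, fun i hi => ?_, ?_⟩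
  · obtain ⟨b, hb, hbpar, hb0⟩ := hT.exists_rk_eq_zero ha
    by_contra h0
    have := (hord b hb a ha hbpar).mp (by omega)
    exact (hmin b hb).not_gt this
  · by_cases hiI : i ∈ (Finset.Icc 1 n).erase r
    · exact (hmin i hiI).not_gt (htail i hiI a ha hi)
    · obtain rfl : i = a := (hT.2.2 i hiI).1.symm.trans hi
      exact hiI ha
  · by_contra hfar
    refine hnone (min (A.par a) a + 1) (Finset.mem_Icc.mpr ?_) ?_ ?_ <;> omega

theorem par_eq_and_ne_imp_mem {I : Finset ℕ} {r i k : ℕ} {A : PreTree}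
    (hA : A.IsTreeDiagram I r) (h : A.par i = k ∧ i ≠ k) : i ∈ I.erase r := by
  by_contra hi
  exact h.2 ((hA.2.2 i hi).1.symm.trans h.1)

theorem qcount_etree : qcount 2 1 etree = 1 := by decide

theorem qcount_ebar : qcount 2 2 ebar = 1 := by decide

end PreTree

theorem embP_etree (k p : ℕ) : embP k 2 1 p = skip (k + 1) p := by
  unfold embP skip; split_ifs <;> omega

theorem invP_etree {k i : ℕ} : invP k 2 1 i = unskip (k + 1) i := by
  unfold invP unskip; split_ifs <;> omega

theorem embP_ebar (k p : ℕ) : embP k 2 2 p = skip k p := by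
  unfold embP skip; split_ifs <;> omega

theorem invP_ebar {k i : ℕ} : invP k 2 2 i = unskip k i := by
  unfold invP unskip; split_ifs <;> omega

namespace PreTree

/-- Restoring the deleted string's influence on ranks recovers the rank function. -/
theorem rk_deleteString_unskip {I : Finset ℕ} {r a i : ℕ} {A : PreTree}
    (hA : A.IsTreeDiagram I r) (ha : a ∈ I.erase r) (hrk : A.rk a = 0)
    (hleaf : ∀ i, A.par i ≠ a) (hi : i ≠ a) :
    (if (A.deleteString a).par (unskip a i) = unskip a (A.par a) ∧
        unskip a i ≠ unskip a (A.par a)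
      then (A.deleteString a).rk (unskip a i) + 1
      else (A.deleteString a).rk (unskip a i)) = A.rk i := by
  have hinj {x y : ℕ} (hx : x ≠ a) (hy : y ≠ a) : unskip a x = unskip a y ↔ x = y :=
    ⟨fun h => by rw [← skip_unskip hx, h, skip_unskip hy], congrArg _⟩
  simp only [deleteString, skip_unskip hi, hinj (hleaf i) (hleaf a), ne_eq, hinj hi (hleaf a)]
  split_ifs with h
  · have := hA.rk_pos ha hrk (par_eq_and_ne_imp_mem hA h) h.1 hi
    omega
  · rfl

theorem eq_stack_etree {I : Finset ℕ} {r k : ℕ} {A : PreTree}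
    (hA : A.IsTreeDiagram I r) (ha : k + 1 ∈ I.erase r) (hrk : A.rk (k + 1) = 0)
    (hleaf : ∀ i, A.par i ≠ k + 1) (hpar : A.par (k + 1) = k) :
    A = stack k 2 1 (A.deleteString (k + 1)) etree := by
  have hk : unskip (k + 1) k = k := by simp [unskip]
  have hcond (i : ℕ) : (k ≤ i ∧ i ≤ k + 2 - 1 ∧ i ≠ k + 1 - 1) ↔ i = k + 1 := by omega
  obtain ⟨par, rk⟩ := A
  simp only [stack, PreTree.mk.injEq, hcond, embP_etree, invP_etree, qcount_etree]
  refine ⟨funext fun i => ?_, funext fun i => ?_⟩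
  · by_cases hi : i = k + 1
    · subst hi
      simpa [etree] using hpar
    · rw [if_neg hi]
      simp only [deleteString, skip_unskip hi]
      exact (skip_unskip (hleaf i)).symm
  · by_cases hi : i = k + 1
    · subst hi
      simpa [etree] using hrk
    · rw [if_neg hi]
      have := rk_deleteString_unskip hA ha hrk hleaf hi
      rw [hpar, hk] at this
      exact this.symm

theorem eq_stack_ebar {I : Finset ℕ} {r k : ℕ} {A : PreTree}
    (hA : A.IsTreeDiagram I r) (ha : k ∈ I.erase r) (hrk : A.rk k = 0)
    (hleaf : ∀ i, A.par i ≠ k) (hpar : A.par k = k + 1) :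
    A = stack k 2 2 (A.deleteString k) ebar := by
  have hk : unskip k (k + 1) = k := by simp [unskip]
  have hcond (i : ℕ) : (k ≤ i ∧ i ≤ k + 2 - 1 ∧ i ≠ k + 2 - 1) ↔ i = k := by omega
  obtain ⟨par, rk⟩ := A
  simp only [stack, PreTree.mk.injEq, hcond, embP_ebar, invP_ebar, qcount_ebar]
  refine ⟨funext fun i => ?_, funext fun i => ?_⟩
  · by_cases hi : i = k
    · subst hi
      simpa [ebar] using hpar
    · rw [if_neg hi]
      simp only [deleteString, skip_unskip hi]
      exact (skip_unskip (hleaf i)).symm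
  · by_cases hi : i = k
    · subst hi
      simpa [ebar] using hrk
    · rw [if_neg hi]
      have := rk_deleteString_unskip hA ha hrk hleaf hi
      rw [hpar, hk] at this
      exact this.symm

end PreTree

/-- **Recursive decomposition of planar tree diagrams.**  Every
`A ∈ 𝒜(n;r)` with `n ≥ 2` is of the form `A' ≺ₖ e` or `A' ≺ₖ ē` for some
`k ∈ {1,…,n-1}` and some planar tree diagram `A'` (the trivial diagram when
`n = 2`), where `A' ∈ 𝒜(n-1;r)` if `k ≥ r` (resp. `k > r`) and
`A' ∈ 𝒜(n-1;r-1)` if `k < r` (resp. `k ≤ r`). -/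
theorem tree_recursive_decomposition (n r : ℕ) (hn : 2 ≤ n)
    (hr : 1 ≤ r) (hrn : r ≤ n) (A : PreTree) (hA : A ∈ TreeSetFull n r) :
    ∃ k, 1 ≤ k ∧ k ≤ n - 1 ∧ ∃ A' : PreTree,
      (A = stack k 2 1 A' etree ∧
        (r ≤ k → A' ∈ TreeSetFull (n - 1) r) ∧
        (k < r → A' ∈ TreeSetFull (n - 1) (r - 1))) ∨
      (A = stack k 2 2 A' ebar ∧
        (r < k → A' ∈ TreeSetFull (n - 1) r) ∧
        (k ≤ r → A' ∈ TreeSetFull (n - 1) (r - 1))) := by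
  obtain ⟨a, ha, hrk, hleaf, hadj⟩ := PreTree.exists_top_leaf hn hA
  have hmem := PreTree.deleteString_mem_treeSetFull hA ha hrk hleaf
  have hpar := Finset.mem_Icc.mp (hA.1.1 a ha).1
  obtain ⟨har, haI⟩ := Finset.mem_erase.mp ha
  rw [Finset.mem_Icc] at haI
  have hlt (h : r < a) : A.deleteString a ∈ TreeSetFull (n - 1) r := by
    rwa [unskip, if_pos h] at hmem
  have hgt (h : a < r) : A.deleteString a ∈ TreeSetFull (n - 1) (r - 1) := by
    rwa [unskip, if_neg h.not_gt] at hmem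
  rcases hadj with h | h
  · obtain ⟨k, rfl⟩ : ∃ k, a = k + 1 := ⟨A.par a, h.symm⟩
    have hk : A.par (k + 1) = k := by omega
    exact ⟨k, by omega, by omega, A.deleteString (k + 1),
      .inl ⟨PreTree.eq_stack_etree hA.1 ha hrk hleaf hk, fun _ => hlt (by omega),
        fun _ => hgt (by omega)⟩⟩
  · exact ⟨a, by omega, by omega, A.deleteString a,
      .inr ⟨PreTree.eq_stack_ebar hA.1 ha hrk hleaf h, hlt, fun _ => hgt (by omega)⟩⟩
end

section
/- Top arrows of planar tree diagrams are short: let A ∈ 𝒜(n;t) be a planar tree diagram and let α be an arrow of A with head on string i and tail on string j, such that no arrowhead of A lies above the head of α on string i and no arrowhead of A lies above the tail of α on string j. Then j = i+1 if i < j, and j = i−1 if i > j; in particular |i − j| = 1. -/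
open scoped BigOperators

/-- No string lies strictly between the head and the tail of a top arrow of a planar tree diagram:
the arrow tailed at the lowest such string would have nowhere to put its head. -/
theorem PreTree.not_between_of_top_arrow {I : Finset ℕ} {t : ℕ} {A : PreTree}
    (hA : A ∈ TreeSet I t) {a : ℕ} (ha : a ∈ I.erase t)
    (htophead : ∀ b ∈ I.erase t, A.par b = A.par a → A.rk a ≤ A.rk b)
    (htoptail : ∀ b ∈ I.erase t, A.par b ≠ a) (k : ℕ) (hk : k ∈ I) :
    ¬ (min (A.par a) a < k ∧ k < max (A.par a) a) := by
  obtain ⟨⟨hpar, hinj, -⟩, h, -, hrk, hchild, hcross⟩ := hA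
  intro hbetween
  obtain ⟨m, hm, hmax⟩ :=
    (I.filter fun k => min (A.par a) a < k ∧ k < max (A.par a) a).exists_max_image h
    ⟨k, Finset.mem_filter.2 ⟨hk, hbetween⟩⟩
  obtain ⟨hmI, hm₁, hm₂⟩ := Finset.mem_filter.1 hm
  obtain ⟨hmt, hma⟩ := hcross a ha m hmI hm₁ hm₂
  have hm' : m ∈ I.erase t := Finset.mem_erase.2 ⟨hmt, hmI⟩
  have hpI := (hpar m hm').1
  have hpa := htoptail m hm'
  have hpi : A.par m ≠ A.par a := by
    intro he
    have hne : A.rk a ≠ A.rk m := fun hr => by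
      have := hinj a ha m hm' he.symm hr
      omega
    have := (hrk a ha m hm' he.symm).1 (lt_of_le_of_ne (htophead m hm' he) hne)
    exact lt_asymm this hma
  have hpin : ¬ (min (A.par a) a < A.par m ∧ A.par m < max (A.par a) a) := by
    rintro ⟨h₁, h₂⟩
    have hpt := (hcross a ha _ hpI h₁ h₂).1
    exact (hmax _ (Finset.mem_filter.2 ⟨hpI, h₁, h₂⟩)).not_gt
      (hchild m hm' _ (Finset.mem_erase.2 ⟨hpt, hpI⟩) rfl)
  have hover : (min (A.par m) m < a ∧ a < max (A.par m) m) ∨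
      (min (A.par m) m < A.par a ∧ A.par a < max (A.par m) m) := by
    omega
  rcases hover with ⟨h₁, h₂⟩ | ⟨h₁, h₂⟩
  · exact lt_asymm hma (hcross m hm' a (Finset.mem_of_mem_erase ha) h₁ h₂).2
  · have hiI := (hpar a ha).1
    obtain ⟨hit, him⟩ := hcross m hm' _ hiI h₁ h₂
    have := hchild a ha _ (Finset.mem_erase.2 ⟨hit, hiI⟩) rfl
    exact lt_asymm hma (this.trans him)

/-- **Top arrows of planar tree diagrams are short.**  Let `A ∈ 𝒜(n;t)` and
let `α` be the arrow of `A` tailed at the string `a` (so with head on the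
string `i = par a` and tail on the string `j = a`).  If no arrowhead of `A`
lies above the head of `α` on the string `i` (i.e. the head of `α` has minimal
rank there) and no arrowhead of `A` lies above the tail of `α` on the string
`j` (i.e. there is no arrowhead at all on the string `j`), then `j = i + 1`
when `i < j` and `j = i - 1` when `i > j`; in particular `|i - j| = 1`. -/
theorem top_arrow_short (n t : ℕ) (A : PreTree) (hA : A ∈ TreeSetFull n t)
    (a : ℕ) (ha : a ∈ (Finset.Icc 1 n).erase t)
    (htophead : ∀ b ∈ (Finset.Icc 1 n).erase t,
      A.par b = A.par a → A.rk a ≤ A.rk b)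
    (htoptail : ∀ b ∈ (Finset.Icc 1 n).erase t, A.par b ≠ a) :
    (A.par a < a → a = A.par a + 1) ∧ (a < A.par a → A.par a = a + 1) := by
  have hnone := PreTree.not_between_of_top_arrow hA ha htophead htoptail
  have hi := Finset.mem_Icc.1 (hA.1.1 a ha).1
  have haI := Finset.mem_Icc.1 (Finset.mem_of_mem_erase ha)
  constructor
  · intro hlt
    have := hnone (A.par a + 1) (Finset.mem_Icc.2 (by omega))
    omega
  · intro hlt
    have := hnone (a + 1) (Finset.mem_Icc.2 (by omega))
    omega
end
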